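/- Let m ≥ 1, and let l₁, l₂ ∈ ℂ satisfy either (a) Re l₁ ≥ 0 and Re l₂ > m, or (b) Re l₁ ≤ 0 and Re l₂ + (Re l₁)/m > m. Then for every z ∈ ℌ_m and any set R of representatives of the cosets Γ_∞\Γ, the series S_τ(z,l₁,l₂) = ∑_{γ ∈ R} exp(2πi·tr(τ(γ·z))) · tr(τ·Im(γ·z))^{l₁} · det(Im(γ·z))^{l₂} converges absolutely, uniformly for (l₁,l₂) in compact subsets of the stated region; moreover, for fixed (l₁,l₂) the sum of the absolute values of the summands is bounded by a constant depending only on m, l₁, l₂ (independent of z ∈ ℌ_m and of τ). -/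

import Mathlib

open Matrix MeasureTheory Filter Topology

noncomputable section

/-- The matrix `W = [[0,−E_m],[E_m,0]]` of the standard symplectic form. -/
def Wmat (m : ℕ) : Matrix (Fin m ⊕ Fin m) (Fin m ⊕ Fin m) ℝ :=
  Matrix.fromBlocks 0 (-1) 1 0

/-- `g ∈ Sp_m(ℝ)`, i.e. `gᵀ W g = W`. -/
def IsSymplectic {m : ℕ} (g : Matrix (Fin m ⊕ Fin m) (Fin m ⊕ Fin m) ℝ) : Prop :=
  gᵀ * Wmat m * g = Wmat m

/-- All entries of `g` are integers. -/
def IsIntegralMat {m : ℕ} (g : Matrix (Fin m ⊕ Fin m) (Fin m ⊕ Fin m) ℝ) : Prop :=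
  ∀ i j, ∃ n : ℤ, g i j = (n : ℝ)

/-- Imaginary part of a complex matrix, as a real matrix. -/
def imPart {m : ℕ} (z : Matrix (Fin m) (Fin m) ℂ) : Matrix (Fin m) (Fin m) ℝ :=
  Matrix.of fun i j => (z i j).im

/-- Real part of a complex matrix, as a real matrix. -/
def rePart {m : ℕ} (z : Matrix (Fin m) (Fin m) ℂ) : Matrix (Fin m) (Fin m) ℝ :=
  Matrix.of fun i j => (z i j).re

/-- The Siegel upper half space `ℌ_m` of genus `m`. -/
def SiegelUHS (m : ℕ) : Set (Matrix (Fin m) (Fin m) ℂ) :=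
  {z | z.IsSymm ∧ (imPart z).PosDef}

/-- A real matrix viewed as a complex matrix. -/
def cmat {m : ℕ} (A : Matrix (Fin m) (Fin m) ℝ) : Matrix (Fin m) (Fin m) ℂ :=
  A.map Complex.ofReal

/-- The action `g·z = (az+b)(cz+d)⁻¹` of `Sp_m(ℝ)` on `ℌ_m`. -/
def act {m : ℕ} (g : Matrix (Fin m ⊕ Fin m) (Fin m ⊕ Fin m) ℝ)
    (z : Matrix (Fin m) (Fin m) ℂ) : Matrix (Fin m) (Fin m) ℂ :=
  (cmat (Matrix.toBlocks₁₁ g) * z + cmat (Matrix.toBlocks₁₂ g)) *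
    (cmat (Matrix.toBlocks₂₁ g) * z + cmat (Matrix.toBlocks₂₂ g))⁻¹

/-- The factor of automorphy `j(g,z) = det(cz + d)`. -/
def autFactor {m : ℕ} (g : Matrix (Fin m ⊕ Fin m) (Fin m ⊕ Fin m) ℝ)
    (z : Matrix (Fin m) (Fin m) ℂ) : ℂ :=
  (cmat (Matrix.toBlocks₂₁ g) * z + cmat (Matrix.toBlocks₂₂ g)).det

/-- The group of translations
`Γ_∞ = {[[±E_m, S],[0, ±E_m]] : S integral symmetric}`. -/
def GammaInf (m : ℕ) : Set (Matrix (Fin m ⊕ Fin m) (Fin m ⊕ Fin m) ℝ) :=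
  {g | ∃ (ε : ℝ) (S : Matrix (Fin m) (Fin m) ℝ), (ε = 1 ∨ ε = -1) ∧
      (∀ i j, ∃ n : ℤ, S i j = (n : ℝ)) ∧ S.IsSymm ∧
      g = Matrix.fromBlocks (ε • 1) S 0 (ε • 1)}

/-- `Γ` is a subgroup of finite index in `Sp_m(ℤ)` containing `Γ_∞`. -/
structure IsModularSubgroup (m : ℕ)
    (Γ : Set (Matrix (Fin m ⊕ Fin m) (Fin m ⊕ Fin m) ℝ)) : Prop where
  symplectic : ∀ γ ∈ Γ, IsSymplectic γ
  integral : ∀ γ ∈ Γ, IsIntegralMat γ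
  one_mem : (1 : Matrix (Fin m ⊕ Fin m) (Fin m ⊕ Fin m) ℝ) ∈ Γ
  mul_mem : ∀ γ ∈ Γ, ∀ δ ∈ Γ, γ * δ ∈ Γ
  inv_mem : ∀ γ ∈ Γ, γ⁻¹ ∈ Γ
  gammaInf_subset : GammaInf m ⊆ Γ
  finiteIndex : ∃ T : Finset (Matrix (Fin m ⊕ Fin m) (Fin m ⊕ Fin m) ℝ),
      ∀ g, IsSymplectic g → IsIntegralMat g → ∃ t ∈ T, ∃ γ ∈ Γ, g = γ * t

/-- `R` is a set of representatives of the cosets `Γ_∞\Γ`. -/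
def IsReps (m : ℕ) (Γ R : Set (Matrix (Fin m ⊕ Fin m) (Fin m ⊕ Fin m) ℝ)) : Prop :=
  R ⊆ Γ ∧ ∀ γ ∈ Γ, ∃! ρ, ρ ∈ R ∧ ∃ δ ∈ GammaInf m, γ = δ * ρ

/-- `τ` is half-integral: integral diagonal entries and off-diagonal entries in `½ℤ`. -/
def HalfIntegral {m : ℕ} (τ : Matrix (Fin m) (Fin m) ℝ) : Prop :=
  (∀ i, ∃ n : ℤ, τ i i = (n : ℝ)) ∧ ∀ i j, i ≠ j → ∃ n : ℤ, τ i j = (n : ℝ) / 2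

/-- The summand of the series `S_τ(z, l₁, l₂)`:
`exp(2πi tr(τ(γ·z))) · tr(τ·Im(γ·z))^{l₁} · det(Im(γ·z))^{l₂}`. -/
def term0 {m : ℕ} (τ : Matrix (Fin m) (Fin m) ℝ) (l₁ l₂ : ℂ)
    (γ : Matrix (Fin m ⊕ Fin m) (Fin m ⊕ Fin m) ℝ) (z : Matrix (Fin m) (Fin m) ℂ) : ℂ :=
  Complex.exp (2 * (Real.pi : ℂ) * Complex.I * (cmat τ * act γ z).trace) *
    (((τ * imPart (act γ z)).trace : ℝ) : ℂ) ^ l₁ *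
    (((imPart (act γ z)).det : ℝ) : ℂ) ^ l₂

/-- The region of convergence of `S_τ`: (a) `Re l₁ ≥ 0` and `Re l₂ > m`, or
(b) `Re l₁ ≤ 0` and `Re l₂ + Re l₁/m > m`. -/
def Region0 (m : ℕ) : Set (ℂ × ℂ) :=
  {p | (0 ≤ p.1.re ∧ (m : ℝ) < p.2.re) ∨ (p.1.re ≤ 0 ∧ (m : ℝ) < p.2.re + p.1.re / m)}

/-- A polynomial factor is absorbed by an exponential. -/
lemma exists_one_add_rpow_le_exp (M : ℝ) :
    ∃ C : ℝ, 0 < C ∧ ∀ t : ℝ, 0 ≤ t → (1 + t) ^ M ≤ C * Real.exp t := by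
  obtain ⟨n, hn⟩ := exists_nat_ge M
  refine ⟨n.factorial * Real.exp 1, by positivity, fun t ht => ?_⟩
  have h1 : (1 + t) ^ M ≤ (1 + t) ^ (n : ℝ) :=
    Real.rpow_le_rpow_of_exponent_le (by linarith) hn
  have h2 := Real.pow_div_factorial_le_exp (1 + t) (by linarith) n
  rw [div_le_iff₀ (by positivity), Real.exp_add] at h2
  rw [Real.rpow_natCast] at h1
  nlinarith

/-- On a compact subset of the region, the absolute values of the summands, written in terms of
`t = tr(τy)` and `d = det y`, have a common majorant `C e^{-t} d^σ` with `m < σ < m + 1`. -/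
lemma exists_majorant {m : ℕ} (hm : 1 ≤ m) {K : Set (ℂ × ℂ)} (hK : IsCompact K)
    (hKR : K ⊆ Region0 m) {c : ℝ} (hc : 0 < c) :
    ∃ σ C : ℝ, (m : ℝ) < σ ∧ σ < m + 1 ∧ 0 ≤ C ∧ ∀ p ∈ K, ∀ t d : ℝ, 0 < t → 0 < d →
      d ≤ (c * t) ^ m →
      Real.exp (-(2 * Real.pi * t)) * t ^ p.1.re * d ^ p.2.re ≤ C * (Real.exp (-t) * d ^ σ) := by
  have hm0 : (0 : ℝ) < m := by exact_mod_cast hm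
  rcases K.eq_empty_or_nonempty with rfl | hne
  · exact ⟨m + 1 / 2, 0, by linarith, by linarith, le_rfl, by simp⟩
  obtain ⟨q, hq, hmin⟩ := hK.exists_isMinOn hne
    (f := fun p : ℂ × ℂ => p.2.re + min 0 p.1.re / m) (by fun_prop)
  have hpos : ∀ p ∈ K, (m : ℝ) < p.2.re + min 0 p.1.re / m := by
    intro p hp
    rcases hKR hp with ⟨h1, h2⟩ | ⟨h1, h2⟩
    · simpa [min_eq_left h1] using h2
    · simpa [min_eq_right h1] using h2
  obtain ⟨M₁, hM₁⟩ := hK.exists_bound_of_continuousOn (f := fun p : ℂ × ℂ => p.1.re) (by fun_prop)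
  obtain ⟨M₂, hM₂⟩ := hK.exists_bound_of_continuousOn (f := fun p : ℂ × ℂ => p.2.re) (by fun_prop)
  have hq' := hpos q hq
  set e := q.2.re + min 0 q.1.re / m with he
  obtain ⟨C₁, hC₁, hexp⟩ := exists_one_add_rpow_le_exp (M₁ + m * M₂)
  have hσ1 : (m : ℝ) < min e (m + 1 / 2) := lt_min hq' (by linarith)
  have hσ2 : min e (m + 1 / 2) ≤ (m : ℝ) + 1 / 2 := min_le_right _ _
  have hσe : min e (m + 1 / 2) ≤ e := min_le_left _ _
  set σ := min e (m + 1 / 2)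
  refine ⟨σ, (1 + c) ^ (m * M₂) * C₁, hσ1, by linarith, by positivity, ?_⟩
  intro p hp t d ht hd hdt
  have hb : σ + -(min 0 p.1.re / m) ≤ p.2.re := by
    have : e ≤ p.2.re + min 0 p.1.re / m := hmin hp
    linarith
  have hmin0 : min 0 p.1.re / m ≤ 0 := div_nonpos_of_nonpos_of_nonneg (min_le_left _ _) hm0.le
  have hM1 : p.1.re ≤ M₁ := (le_abs_self _).trans (hM₁ p hp)
  have hM2 : p.2.re ≤ M₂ := (le_abs_self _).trans (hM₂ p hp)
  set a := p.1.re
  set b := p.2.re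
  have hbσ : 0 ≤ b - σ := by linarith
  have hexpo : 0 ≤ a + m * (b - σ) := by
    have h1 : -(min 0 a / m) ≤ b - σ := by linarith
    have h2 : -(min 0 a) ≤ m * (b - σ) := by
      have := mul_le_mul_of_nonneg_left h1 hm0.le
      rwa [mul_neg, mul_div_cancel₀ _ hm0.ne'] at this
    have := min_le_right 0 a
    linarith
  have hd1 : d ^ (b - σ) ≤ (1 + c) ^ (m * M₂) * t ^ (m * (b - σ)) := by
    calc d ^ (b - σ) ≤ ((c * t) ^ m) ^ (b - σ) := Real.rpow_le_rpow hd.le hdt hbσ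
      _ = (c * t) ^ (m * (b - σ)) := by
        rw [← Real.rpow_natCast, ← Real.rpow_mul (by positivity)]
      _ = c ^ (m * (b - σ)) * t ^ (m * (b - σ)) := Real.mul_rpow hc.le ht.le
      _ ≤ (1 + c) ^ (m * M₂) * t ^ (m * (b - σ)) := by
        gcongr
        calc c ^ (m * (b - σ)) ≤ (1 + c) ^ (m * (b - σ)) := by gcongr; linarith
          _ ≤ _ := by
            apply Real.rpow_le_rpow_of_exponent_le (by linarith)
            gcongr
            linarith
  have ht1 : t ^ a * t ^ (m * (b - σ)) ≤ C₁ * Real.exp t := by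
    rw [← Real.rpow_add ht]
    calc t ^ (a + m * (b - σ)) ≤ (1 + t) ^ (a + m * (b - σ)) := by gcongr; linarith
      _ ≤ (1 + t) ^ (M₁ + m * M₂) := by
        apply Real.rpow_le_rpow_of_exponent_le (by linarith)
        gcongr
        linarith
      _ ≤ _ := hexp t ht.le
  have hpi : Real.exp (-(2 * Real.pi * t)) * Real.exp t ≤ Real.exp (-t) := by
    rw [← Real.exp_add]
    apply Real.exp_le_exp.mpr
    nlinarith [Real.pi_gt_three]
  have hdb : d ^ b = d ^ (b - σ) * d ^ σ := by rw [← Real.rpow_add hd]; ring_nf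
  calc Real.exp (-(2 * Real.pi * t)) * t ^ a * d ^ b
      = Real.exp (-(2 * Real.pi * t)) * t ^ a * d ^ σ * d ^ (b - σ) := by rw [hdb]; ring
    _ ≤ Real.exp (-(2 * Real.pi * t)) * t ^ a * d ^ σ *
        ((1 + c) ^ (m * M₂) * t ^ (m * (b - σ))) := by gcongr
    _ = (1 + c) ^ (m * M₂) * d ^ σ * Real.exp (-(2 * Real.pi * t)) *
        (t ^ a * t ^ (m * (b - σ))) := by ring
    _ ≤ (1 + c) ^ (m * M₂) * d ^ σ * Real.exp (-(2 * Real.pi * t)) * (C₁ * Real.exp t) := by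
        gcongr
    _ = (1 + c) ^ (m * M₂) * C₁ * d ^ σ * (Real.exp (-(2 * Real.pi * t)) * Real.exp t) := by ring
    _ ≤ (1 + c) ^ (m * M₂) * C₁ * d ^ σ * Real.exp (-t) := by gcongr
    _ = _ := by ring

/-- The value `xᵀ τ x` of the quadratic form with matrix `τ`. -/
def quadForm {ι : Type*} [Fintype ι] (τ : Matrix ι ι ℝ) (x : ι → ℝ) : ℝ := x ⬝ᵥ τ *ᵥ x

/-- An integral matrix viewed as a real matrix. -/
def realMat {ι : Type*} (U : Matrix ι ι ℤ) : Matrix ι ι ℝ := U.map (Int.cast : ℤ → ℝ)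

lemma quadForm_congr {ι : Type*} [Fintype ι] (τ U : Matrix ι ι ℝ) (x : ι → ℝ) :
    quadForm (Uᵀ * τ * U) x = quadForm τ (U *ᵥ x) := by
  unfold quadForm
  rw [← Matrix.mulVec_mulVec, ← Matrix.mulVec_mulVec, Matrix.dotProduct_mulVec,
    Matrix.vecMul_transpose]

lemma realMat_mul {ι : Type*} [Fintype ι] (U V : Matrix ι ι ℤ) :
    realMat (U * V) = realMat U * realMat V := by
  ext i j
  simp [realMat, Matrix.mul_apply]

lemma realMat_one {ι : Type*} [DecidableEq ι] : realMat (1 : Matrix ι ι ℤ) = 1 := by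
  ext i j
  simp [realMat, Matrix.one_apply, apply_ite]

lemma realMat_det {ι : Type*} [Fintype ι] [DecidableEq ι] (U : Matrix ι ι ℤ) :
    (realMat U).det = U.det :=
  (Int.cast_det U).symm

lemma realMat_mulVec_inj {ι : Type*} [Fintype ι] [DecidableEq ι] {U : Matrix ι ι ℤ}
    (hU : IsUnit U.det) {x : ι → ℝ} (hx : x ≠ 0) : realMat U *ᵥ x ≠ 0 := by
  intro h
  have : IsUnit (realMat U) := by
    rw [Matrix.isUnit_iff_isUnit_det, realMat_det]
    exact hU.map (Int.castRingHom ℝ)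
  exact hx (Matrix.mulVec_injective_of_isUnit this (by simpa using h))

/-- Completing the square in the first variable. -/
lemma quadForm_cons {m : ℕ} {τ : Matrix (Fin (m + 1)) (Fin (m + 1)) ℝ} (hτ : τ.IsSymm)
    (h0 : τ 0 0 ≠ 0) (s : ℝ) (w : Fin m → ℝ) :
    quadForm τ (Fin.cons s w) =
      τ 0 0 * (s + (fun j => τ 0 j.succ / τ 0 0) ⬝ᵥ w) ^ 2 +
        quadForm (Matrix.of fun i j : Fin m =>
          τ i.succ j.succ - τ 0 i.succ * τ 0 j.succ / τ 0 0) w := by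
  have hs : ∀ i : Fin m, τ i.succ 0 = τ 0 i.succ := fun i => hτ.apply 0 i.succ
  have e1 : ((fun j : Fin m => τ 0 j.succ / τ 0 0) ⬝ᵥ w) = (∑ j, τ 0 j.succ * w j) / τ 0 0 := by
    simp only [dotProduct, Finset.sum_div]
    exact Finset.sum_congr rfl fun j _ => by ring
  have e2 : quadForm (Matrix.of fun i j : Fin m =>
          τ i.succ j.succ - τ 0 i.succ * τ 0 j.succ / τ 0 0) w =
      (∑ i, ∑ j, w i * (τ i.succ j.succ * w j)) - (∑ j, τ 0 j.succ * w j) ^ 2 / τ 0 0 := by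
    simp only [quadForm, dotProduct, mulVec, Finset.mul_sum, Matrix.of_apply]
    rw [sq, Finset.sum_mul_sum, Finset.sum_div, ← Finset.sum_sub_distrib]
    refine Finset.sum_congr rfl fun i _ => ?_
    rw [Finset.sum_div, ← Finset.sum_sub_distrib]
    exact Finset.sum_congr rfl fun j _ => by ring
  have e3 : quadForm τ (Fin.cons s w) =
      τ 0 0 * s ^ 2 + 2 * s * (∑ j, τ 0 j.succ * w j) +
        ∑ i, ∑ j, w i * (τ i.succ j.succ * w j) := by
    simp only [quadForm, dotProduct, mulVec, Fin.sum_univ_succ, Fin.cons_zero, Fin.cons_succ, hs,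
      mul_add, Finset.sum_add_distrib, Finset.mul_sum]
    have : ∑ i : Fin m, w i * (τ 0 i.succ * s) = ∑ i : Fin m, s * (τ 0 i.succ * w i) :=
      Finset.sum_congr rfl fun j _ => by ring
    rw [this]
    have : ∑ i : Fin m, 2 * s * (τ 0 i.succ * w i) = 2 * ∑ i : Fin m, s * (τ 0 i.succ * w i) := by
      rw [Finset.mul_sum]
      exact Finset.sum_congr rfl fun j _ => by ring
    rw [this]
    ring
  rw [e1, e2, e3]
  field_simp
  ring

/-- The integral matrix with first row `(1, n)`, first column `(1, 0)` and lower right block `U`. -/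
def borderMat {m : ℕ} (n : Fin m → ℤ) (U : Matrix (Fin m) (Fin m) ℤ) :
    Matrix (Fin (m + 1)) (Fin (m + 1)) ℤ :=
  Matrix.of (Fin.cons (Fin.cons 1 n) fun i => Fin.cons 0 (U i))

lemma borderMat_det {m : ℕ} (n : Fin m → ℤ) (U : Matrix (Fin m) (Fin m) ℤ) :
    (borderMat n U).det = U.det := by
  rw [Matrix.det_succ_column_zero, Fin.sum_univ_succ]
  have : (borderMat n U).submatrix Fin.succ Fin.succ = U := by
    ext i j
    simp [borderMat]
  simp [borderMat] at this ⊢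
  rw [this]

lemma borderMat_mulVec {m : ℕ} (n : Fin m → ℤ) (U : Matrix (Fin m) (Fin m) ℤ) (s : ℝ)
    (w : Fin m → ℝ) :
    realMat (borderMat n U) *ᵥ (Fin.cons s w : Fin (m + 1) → ℝ) =
      Fin.cons (s + (fun j => (n j : ℝ)) ⬝ᵥ w) (realMat U *ᵥ w) := by
  ext i
  refine Fin.cases ?_ (fun i => ?_) i
  · simp [realMat, borderMat, mulVec, dotProduct, Fin.sum_univ_succ]
  · simp [realMat, borderMat, mulVec, dotProduct, Fin.sum_univ_succ]

lemma exists_int_abs_add_le (a : ℝ) : ∃ n : ℤ, |(n : ℝ) + a| ≤ 1 / 2 := by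
  refine ⟨-round a, ?_⟩
  have := abs_sub_round a
  push_cast
  rwa [neg_add_eq_sub]

/-- Hermite reduction: if all columns of unimodular matrices have `τ`-value at least `μ`, then some
unimodular transform of `τ` is bounded below by a fixed multiple of `μ` times the identity. -/
lemma exists_hermite_reduction (m : ℕ) : ∃ c : ℝ, 0 < c ∧ ∀ τ : Matrix (Fin m) (Fin m) ℝ, τ.IsSymm →
    (∀ x, x ≠ 0 → 0 < quadForm τ x) → ∀ μ : ℝ, 0 < μ →
    (∀ U : Matrix (Fin m) (Fin m) ℤ, IsUnit U.det → ∀ j, μ ≤ quadForm τ ((realMat U).col j)) →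
    ∃ U : Matrix (Fin m) (Fin m) ℤ, IsUnit U.det ∧
      ∀ x, c * μ * (x ⬝ᵥ x) ≤ quadForm τ (realMat U *ᵥ x) := by
  induction m with
  | zero => exact ⟨1, one_pos, fun τ _ _ μ _ _ => ⟨1, by simp, fun x => by
      simp [quadForm, dotProduct]⟩⟩
  | succ m ih =>
    obtain ⟨c, hc, ih⟩ := ih
    refine ⟨(2 + (1 + m / 2) / (c * (7 / 10)))⁻¹, by positivity, ?_⟩
    intro τ hτ hpos μ hμ hmin
    set V : Set ℝ := {r | ∃ U : Matrix (Fin (m + 1)) (Fin (m + 1)) ℤ, IsUnit U.det ∧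
      ∃ j, r = quadForm τ ((realMat U).col j)} with hV
    have hVne : V.Nonempty := ⟨_, 1, by simp, 0, rfl⟩
    have hVlb : ∀ r ∈ V, μ ≤ r := by
      rintro r ⟨U, hU, j, rfl⟩
      exact hmin U hU j
    have hVbdd : BddBelow V := ⟨μ, hVlb⟩
    have hμν : μ ≤ sInf V := le_csInf hVne hVlb
    set ν := sInf V with hν
    have hν0 : 0 < ν := hμ.trans_le hμν
    obtain ⟨_, ⟨U₀, hU₀, j₀, rfl⟩, hlt⟩ := exists_lt_of_csInf_lt hVne
      (show sInf V < 6 / 5 * ν by rw [← hν]; linarith)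
    set U := U₀.submatrix id (Equiv.swap 0 j₀) with hUdef
    have hU : IsUnit U.det := by
      rw [hUdef, Matrix.det_permute']
      exact (Units.isUnit _ |>.map (Int.castRingHom ℤ)).mul hU₀
    have hUcol : (realMat U).col 0 = (realMat U₀).col j₀ := by
      ext i
      simp [hUdef, realMat, Matrix.col]
    set τ' := (realMat U)ᵀ * τ * realMat U with hτ'
    have hq' : ∀ x, quadForm τ' x = quadForm τ (realMat U *ᵥ x) := quadForm_congr τ _
    have hsymm' : τ'.IsSymm := by
      rw [Matrix.IsSymm, hτ', Matrix.transpose_mul, Matrix.transpose_mul, hτ.eq,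
        Matrix.transpose_transpose, Matrix.mul_assoc]
    have hpos' : ∀ x, x ≠ 0 → 0 < quadForm τ' x := fun x hx => by
      rw [hq']
      exact hpos _ (realMat_mulVec_inj hU hx)
    have hmin' : ∀ W : Matrix (Fin (m + 1)) (Fin (m + 1)) ℤ, IsUnit W.det → ∀ j,
        ν ≤ quadForm τ' ((realMat W).col j) := by
      intro W hW j
      refine csInf_le hVbdd ⟨U * W, by rw [Matrix.det_mul]; exact hU.mul hW, j, ?_⟩
      rw [hq', realMat_mul]
      rfl
    have h00 : quadForm τ' ((realMat 1).col 0) = τ' 0 0 := by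
      rw [realMat_one]
      simp [quadForm, dotProduct, mulVec, Matrix.one_apply]
    have hα1 : ν ≤ τ' 0 0 := by
      rw [← h00]
      exact hmin' 1 (by simp) 0
    have hα2 : τ' 0 0 < 6 / 5 * ν := by
      rw [← h00, hq', realMat_one]
      have : realMat U *ᵥ (1 : Matrix (Fin (m + 1)) (Fin (m + 1)) ℝ).col 0 =
          (realMat U).col 0 := by
        ext i
        simp [mulVec, dotProduct, Matrix.one_apply]
      rw [this, hUcol]
      exact hlt
    have hα0 : 0 < τ' 0 0 := hν0.trans_le hα1
    set θ : Fin m → ℝ := fun j => τ' 0 j.succ / τ' 0 0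
    set τ₁ : Matrix (Fin m) (Fin m) ℝ := Matrix.of fun i j : Fin m =>
          τ' i.succ j.succ - τ' 0 i.succ * τ' 0 j.succ / τ' 0 0 with hτ₁
    have hcons : ∀ s w, quadForm τ' (Fin.cons s w) = τ' 0 0 * (s + θ ⬝ᵥ w) ^ 2 + quadForm τ₁ w :=
      quadForm_cons hsymm' hα0.ne'
    have hsymm₁ : τ₁.IsSymm := by
      ext i j
      simp only [hτ₁, Matrix.transpose_apply, Matrix.of_apply, hsymm'.apply i.succ j.succ]
      ring
    have hpos₁ : ∀ x, x ≠ 0 → 0 < quadForm τ₁ x := by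
      intro x hx
      have h := hpos' (Fin.cons (-(θ ⬝ᵥ x)) x) (fun h => hx (by
        ext i
        simpa using congrFun h i.succ))
      rw [hcons] at h
      simpa using h
    have hmin₁ : ∀ W : Matrix (Fin m) (Fin m) ℤ, IsUnit W.det → ∀ j,
        7 / 10 * ν ≤ quadForm τ₁ ((realMat W).col j) := by
      intro W hW j
      obtain ⟨n, hn⟩ := exists_int_abs_add_le (θ ⬝ᵥ (realMat W).col j)
      have h := hmin' (borderMat (fun _ => n) W) (by rwa [borderMat_det]) j.succ
      have hcol : (realMat (borderMat (fun _ => n) W)).col j.succ =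
          Fin.cons (n : ℝ) ((realMat W).col j) := by
        ext i
        refine Fin.cases ?_ (fun i => ?_) i <;> simp [realMat, borderMat, Matrix.col]
      rw [hcol, hcons] at h
      have hsq : ((n : ℝ) + θ ⬝ᵥ (realMat W).col j) ^ 2 ≤ 1 / 4 := by
        rw [← sq_abs]
        nlinarith [abs_nonneg ((n : ℝ) + θ ⬝ᵥ (realMat W).col j)]
      nlinarith
    obtain ⟨U₁, hU₁, hred⟩ := ih τ₁ hsymm₁ hpos₁ (7 / 10 * ν) (by positivity) hmin₁
    choose n hn using fun j => exists_int_abs_add_le ((θ ᵥ* realMat U₁) j)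
    refine ⟨U * borderMat n U₁, by
      rw [Matrix.det_mul, borderMat_det]
      exact hU.mul hU₁, ?_⟩
    intro x
    obtain ⟨s, w, rfl⟩ : ∃ s w, x = Fin.cons s w := ⟨x 0, Fin.tail x, (Fin.cons_self_tail x).symm⟩
    rw [realMat_mul, ← Matrix.mulVec_mulVec, ← hq', borderMat_mulVec, hcons, add_assoc,
      Matrix.dotProduct_mulVec, ← add_dotProduct]
    set η : Fin m → ℝ := (fun j => (n j : ℝ)) + θ ᵥ* realMat U₁
    have hη : (η ⬝ᵥ w) ^ 2 ≤ m / 4 * (w ⬝ᵥ w) := by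
      have h1 : (η ⬝ᵥ w) ^ 2 ≤ (∑ j, η j ^ 2) * ∑ j, w j ^ 2 :=
        Finset.sum_mul_sq_le_sq_mul_sq _ _ _
      have h2 : ∑ j, η j ^ 2 ≤ m / 4 := by
        calc ∑ j, η j ^ 2 ≤ ∑ j : Fin m, (1 / 4 : ℝ) := by
              refine Finset.sum_le_sum fun j _ => ?_
              have := hn j
              rw [← sq_abs]
              have h3 : |η j| ≤ 1 / 2 := this
              nlinarith [abs_nonneg (η j)]
          _ = m / 4 := by simp; ring
      have h3 : w ⬝ᵥ w = ∑ j, w j ^ 2 := by simp [dotProduct, sq]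
      rw [h3]
      exact h1.trans (by gcongr)
    have hw := hred w
    have hww : 0 ≤ w ⬝ᵥ w := by
      simp only [dotProduct]
      exact Finset.sum_nonneg fun i _ => mul_self_nonneg _
    have hxx : (Fin.cons s w : Fin (m + 1) → ℝ) ⬝ᵥ Fin.cons s w = s ^ 2 + w ⬝ᵥ w := by
      simp [dotProduct, Fin.sum_univ_succ, sq]
    rw [hxx, mul_assoc, inv_mul_le_iff₀ (by positivity)]
    set S := s + η ⬝ᵥ w
    have hs : s ^ 2 ≤ 2 * S ^ 2 + 2 * (η ⬝ᵥ w) ^ 2 := by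
      have : s = S - η ⬝ᵥ w := by simp [S]
      rw [this]
      nlinarith [sq_nonneg (S + η ⬝ᵥ w)]
    set Q := quadForm τ₁ (realMat U₁ *ᵥ w)
    have hQ0 : 0 ≤ Q := le_trans (by positivity) hw
    have h4 : ν * (w ⬝ᵥ w) ≤ Q / (c * (7 / 10)) := by
      rw [le_div_iff₀ (by positivity)]
      linarith
    have h5 : ν * S ^ 2 ≤ τ' 0 0 * S ^ 2 := by gcongr
    have h6 : 0 ≤ τ' 0 0 * S ^ 2 := by positivity
    have hm0 : (0 : ℝ) ≤ m := by positivity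
    calc μ * (s ^ 2 + w ⬝ᵥ w) ≤ ν * (s ^ 2 + w ⬝ᵥ w) := by gcongr
      _ ≤ ν * (2 * S ^ 2 + (1 + m / 2) * (w ⬝ᵥ w)) :=
        mul_le_mul_of_nonneg_left (by nlinarith [hs, hη]) hν0.le
      _ = 2 * (ν * S ^ 2) + (1 + m / 2) * (ν * (w ⬝ᵥ w)) := by ring
      _ ≤ 2 * (τ' 0 0 * S ^ 2) + (1 + m / 2) * (Q / (c * (7 / 10))) := by gcongr
      _ ≤ 2 * (τ' 0 0 * S ^ 2) + (1 + m / 2) * (Q / (c * (7 / 10))) + 2 * Q +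
          (1 + m / 2) / (c * (7 / 10)) * (τ' 0 0 * S ^ 2) := by
        have : 0 ≤ (1 + m / 2) / (c * (7 / 10)) * (τ' 0 0 * S ^ 2) := by positivity
        linarith
      _ = (2 + (1 + m / 2) / (c * (7 / 10))) * (τ' 0 0 * S ^ 2 + Q) := by ring

lemma trace_mul_self_transpose {m : ℕ} (τ a : Matrix (Fin m) (Fin m) ℝ) :
    (τ * (a * aᵀ)).trace = ∑ j, quadForm τ (a.col j) := by
  rw [← Matrix.mul_assoc, Matrix.trace_mul_comm, Matrix.trace]
  refine Finset.sum_congr rfl fun j _ => ?_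
  rw [Matrix.diag_apply, Matrix.mul_apply]
  simp [quadForm, dotProduct, mulVec, Matrix.mul_apply]

open scoped MatrixOrder Matrix.Norms.L2Operator in
lemma exists_eq_mul_transpose {m : ℕ} {y : Matrix (Fin m) (Fin m) ℝ} (hy : y.PosDef) :
    ∃ a : Matrix (Fin m) (Fin m) ℝ, IsUnit a.det ∧ y = a * aᵀ := by
  obtain ⟨b, hb⟩ := CStarAlgebra.nonneg_iff_eq_star_mul_self.mp hy.posSemidef.nonneg
  have h : y = bᴴ * b := hb
  refine ⟨bᵀ, ?_, ?_⟩
  · have hd := hy.det_pos.ne'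
    rw [h, Matrix.det_mul] at hd
    rw [Matrix.det_transpose]
    exact (right_ne_zero_of_mul hd).isUnit
  · rw [h, Matrix.transpose_transpose, Matrix.conjTranspose_eq_transpose_of_trivial]

lemma one_le_quadForm_of_halfIntegral {m : ℕ} {τ : Matrix (Fin m) (Fin m) ℝ} (hτ : τ.PosDef)
    (hi : HalfIntegral τ) (x : Fin m → ℤ) (hx : x ≠ 0) :
    1 ≤ quadForm τ (fun i => (x i : ℝ)) := by
  have hpos : 0 < quadForm τ (fun i => (x i : ℝ)) := by
    have hx' : (fun i => (x i : ℝ)) ≠ 0 := by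
      intro h
      apply hx
      ext i
      simpa using congrFun h i
    simpa [quadForm] using hτ.dotProduct_mulVec_pos hx'
  have hint : ∃ n : ℤ, quadForm τ (fun i => (x i : ℝ)) = n := by
    have hs : ∀ i j, τ i j = τ j i := fun i j => by simpa using hτ.1.apply j i
    choose d hd using hi.1
    have hoff : ∀ i j, ∃ n : ℤ, i ≠ j → τ i j = n / 2 := fun i j => by
      by_cases h : i = j
      · exact ⟨0, fun h' => absurd h h'⟩
      · obtain ⟨n, hn⟩ := hi.2 i j h
        exact ⟨n, fun _ => hn⟩
    choose e he using hoff
    refine ⟨∑ i, d i * x i ^ 2 + ∑ i, ∑ j, if i < j then e i j * x i * x j else 0, ?_⟩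
    have key : quadForm τ (fun i => (x i : ℝ)) = ∑ i, ∑ j, (x i * τ i j * x j : ℝ) := by
      simp only [quadForm, dotProduct, mulVec, Finset.mul_sum, mul_assoc]
    have split : ∀ i j, (x i * τ i j * x j : ℝ) = (if i = j then (d i * x i ^ 2 : ℝ) else 0) +
        (if i < j then (e i j * x i * x j / 2 : ℝ) else 0) +
        (if j < i then (e j i * x j * x i / 2 : ℝ) else 0) := by
      intro i j
      rcases lt_trichotomy i j with h | rfl | h
      · rw [if_neg h.ne, if_pos h, if_neg h.not_gt, he i j h.ne]
        ring
      · simp only [lt_irrefl, if_true, if_false, hd]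
        ring
      · rw [if_neg h.ne', if_neg h.not_gt, if_pos h, hs, he j i h.ne]
        ring
    rw [key]
    simp only [split, Finset.sum_add_distrib]
    rw [Finset.sum_comm (f := fun i j => if j < i then (e j i * x j * x i / 2 : ℝ) else 0),
      add_assoc, ← Finset.sum_add_distrib]
    push_cast
    congr 1
    · simp
    · refine Finset.sum_congr rfl fun i _ => ?_
      rw [← Finset.sum_add_distrib]
      refine Finset.sum_congr rfl fun j _ => ?_
      split_ifs
      · ring
      · simp
  obtain ⟨n, hn⟩ := hint
  rw [hn] at hpos ⊢
  have : 0 < n := by exact_mod_cast hpos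
  exact_mod_cast this

/-- For half-integral positive definite `τ`, the linear form `tr(τ y)` dominates the trace of a
unimodular transform of `y`, with a constant depending only on the size. -/
lemma exists_unimodular_trace_le (m : ℕ) : ∃ c : ℝ, 0 < c ∧
    ∀ τ : Matrix (Fin m) (Fin m) ℝ, τ.PosDef → HalfIntegral τ →
    ∃ U V : Matrix (Fin m) (Fin m) ℤ, U * V = 1 ∧
      ∀ y : Matrix (Fin m) (Fin m) ℝ, y.PosDef →
        c * (realMat U * y * (realMat U)ᵀ).trace ≤ (τ * y).trace := by
  obtain ⟨c, hc, H⟩ := exists_hermite_reduction m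
  refine ⟨c, hc, fun τ hτ hi => ?_⟩
  have hsymm : τ.IsSymm := by
    ext i j
    simpa using hτ.1.apply i j
  obtain ⟨V, hV, hred⟩ := H τ hsymm
    (fun x hx => by simpa [quadForm] using hτ.dotProduct_mulVec_pos hx) 1 one_pos (by
      intro U hU j
      refine one_le_quadForm_of_halfIntegral hτ hi (U.col j) ?_
      intro h
      rw [Matrix.det_eq_zero_of_column_eq_zero j (fun i => congrFun h i)] at hU
      simp at hU)
  have hUV : V⁻¹ * V = 1 := Matrix.nonsing_inv_mul _ hV
  have hVU : V * V⁻¹ = 1 := Matrix.mul_nonsing_inv _ hV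
  refine ⟨V⁻¹, V, hUV, fun y hy => ?_⟩
  obtain ⟨a, -, rfl⟩ := exists_eq_mul_transpose hy
  have e : realMat V⁻¹ * (a * aᵀ) * (realMat V⁻¹)ᵀ =
      1 * ((realMat V⁻¹ * a) * (realMat V⁻¹ * a)ᵀ) := by
    rw [Matrix.transpose_mul, Matrix.one_mul]
    simp only [Matrix.mul_assoc]
  rw [e, trace_mul_self_transpose, trace_mul_self_transpose, Finset.mul_sum]
  refine Finset.sum_le_sum fun j _ => ?_
  have h := hred ((realMat V⁻¹ * a).col j)
  have e2 : realMat V *ᵥ (realMat V⁻¹ * a).col j = a.col j := by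
    have : (realMat V⁻¹ * a).col j = realMat V⁻¹ *ᵥ a.col j := by
      ext i
      simp [mulVec, dotProduct, Matrix.mul_apply]
    rw [this, Matrix.mulVec_mulVec, ← realMat_mul, hVU, realMat_one, Matrix.one_mulVec]
  rw [e2, mul_one] at h
  simpa [quadForm] using h

/-- The space of complex symmetric matrices. -/
def symMat (m : ℕ) : Submodule ℂ (Matrix (Fin m) (Fin m) ℂ) where
  carrier := {S | Sᵀ = S}
  add_mem' {a b} ha hb := by
    rw [Set.mem_ofPred_eq] at *
    rw [Matrix.transpose_add, ha, hb]
  zero_mem' := Matrix.transpose_zero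
  smul_mem' c a ha := by
    rw [Set.mem_ofPred_eq] at *
    rw [Matrix.transpose_smul, ha]

lemma mem_symMat {m : ℕ} {S : Matrix (Fin m) (Fin m) ℂ} : S ∈ symMat m ↔ Sᵀ = S := Iff.rfl

/-- The linear map `S ↦ A S Aᵀ` on symmetric matrices. -/
def symCongr {m : ℕ} (A : Matrix (Fin m) (Fin m) ℂ) : symMat m →ₗ[ℂ] symMat m where
  toFun S := ⟨A * S.1 * Aᵀ, by
    rw [mem_symMat, Matrix.transpose_mul, Matrix.transpose_mul, Matrix.transpose_transpose,
      mem_symMat.1 S.2, Matrix.mul_assoc]⟩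
  map_add' S T := by
    ext1
    simp [Matrix.mul_add, Matrix.add_mul]
  map_smul' c S := by
    ext1
    simp

@[simp]
lemma symCongr_apply {m : ℕ} (A : Matrix (Fin m) (Fin m) ℂ) (S : symMat m) :
    (symCongr A S : Matrix (Fin m) (Fin m) ℂ) = A * S.1 * Aᵀ := rfl

lemma symCongr_mul {m : ℕ} (A B : Matrix (Fin m) (Fin m) ℂ) :
    symCongr (A * B) = symCongr A * symCongr B := by
  refine LinearMap.ext fun S => Subtype.ext ?_
  rw [Module.End.mul_apply, symCongr_apply, symCongr_apply, symCongr_apply, Matrix.transpose_mul]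
  simp only [Matrix.mul_assoc]

lemma symCongr_one {m : ℕ} : symCongr (1 : Matrix (Fin m) (Fin m) ℂ) = 1 := by
  refine LinearMap.ext fun S => Subtype.ext ?_
  simp

/-- The symmetric matrix with upper left block `S`, last column `b` and corner `t`. -/
def symBorder (m : ℕ) : ((symMat m × (Fin m → ℂ)) × ℂ) ≃ₗ[ℂ] symMat (m + 1) where
  toFun p := ⟨(Matrix.fromBlocks p.1.1.1 (Matrix.replicateCol (Fin 1) p.1.2)
      (Matrix.replicateRow (Fin 1) p.1.2) (Matrix.of fun _ _ => p.2)).reindex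
        finSumFinEquiv finSumFinEquiv, by
    rw [mem_symMat, Matrix.reindex_apply, Matrix.transpose_submatrix, Matrix.fromBlocks_transpose,
      mem_symMat.1 p.1.1.2]
    rfl⟩
  map_add' p q := by
    ext i j
    obtain ⟨i, rfl⟩ := finSumFinEquiv.surjective i
    obtain ⟨j, rfl⟩ := finSumFinEquiv.surjective j
    rcases i with i | i <;> rcases j with j | j <;> simp
  map_smul' c p := by
    ext i j
    obtain ⟨i, rfl⟩ := finSumFinEquiv.surjective i
    obtain ⟨j, rfl⟩ := finSumFinEquiv.surjective j
    rcases i with i | i <;> rcases j with j | j <;> simp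
  invFun Z := ((⟨Z.1.submatrix (Fin.castAdd 1) (Fin.castAdd 1), by
    rw [mem_symMat, Matrix.transpose_submatrix, mem_symMat.1 Z.2]⟩,
    fun i => Z.1 (Fin.castAdd 1 i) (Fin.natAdd m 0)), Z.1 (Fin.natAdd m 0) (Fin.natAdd m 0))
  left_inv p := by
    refine Prod.ext (Prod.ext (Subtype.ext ?_) ?_) ?_
    · ext i j
      simp only [Matrix.submatrix_apply, Matrix.reindex_apply, finSumFinEquiv_symm_apply_castAdd,
        Matrix.fromBlocks_apply₁₁]
    · ext i
      simp only [Matrix.submatrix_apply, Matrix.reindex_apply, finSumFinEquiv_symm_apply_castAdd,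
        finSumFinEquiv_symm_apply_natAdd, Matrix.fromBlocks_apply₁₂, Matrix.replicateCol_apply]
    · simp only [Matrix.submatrix_apply, Matrix.reindex_apply,
        finSumFinEquiv_symm_apply_natAdd, Matrix.fromBlocks_apply₂₂, Matrix.of_apply]
  right_inv Z := by
    have hs : ∀ i j, Z.1 i j = Z.1 j i := fun i j => congrFun (congrFun (mem_symMat.1 Z.2) j) i
    ext i j
    obtain ⟨i, rfl⟩ := finSumFinEquiv.surjective i
    obtain ⟨j, rfl⟩ := finSumFinEquiv.surjective j
    rcases i with i | i <;> rcases j with j | j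
    · simp
    · fin_cases j
      simp
    · fin_cases i
      simp only [Matrix.reindex_apply, Matrix.submatrix_apply, Equiv.symm_apply_apply,
        Matrix.fromBlocks_apply₂₁, Matrix.replicateRow_apply]
      exact hs _ _
    · fin_cases i
      fin_cases j
      simp

lemma symBorder_coe {m : ℕ} (S : symMat m) (b : Fin m → ℂ) (t : ℂ) :
    (symBorder m ((S, b), t) : Matrix (Fin (m + 1)) (Fin (m + 1)) ℂ) =
      (Matrix.fromBlocks S.1 (Matrix.replicateCol (Fin 1) b)
        (Matrix.replicateRow (Fin 1) b) (Matrix.of fun _ _ => t)).reindex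
          finSumFinEquiv finSumFinEquiv := rfl

lemma symCongr_diagonal_symBorder {m : ℕ} (d : Fin (m + 1) → ℂ) (S : symMat m) (b : Fin m → ℂ)
    (t : ℂ) :
    symCongr (Matrix.diagonal d) (symBorder m ((S, b), t)) =
      symBorder m ((symCongr (Matrix.diagonal fun i => d (Fin.castAdd 1 i)) S,
        Matrix.toLin' (Matrix.diagonal fun i => d (Fin.castAdd 1 i) * d (Fin.natAdd m 0)) b),
        (d (Fin.natAdd m 0) ^ 2) • t) := by
  ext i j
  rw [symCongr_apply, symBorder_coe, symBorder_coe, Matrix.diagonal_transpose,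
    Matrix.mul_diagonal, Matrix.diagonal_mul]
  obtain ⟨i, rfl⟩ := finSumFinEquiv.surjective i
  obtain ⟨j, rfl⟩ := finSumFinEquiv.surjective j
  rcases i with i | i <;> rcases j with j | j
  · simp
  · fin_cases j
    simp [Matrix.mulVec_diagonal]
    ring
  · fin_cases i
    simp [Matrix.mulVec_diagonal]
    ring
  · fin_cases i
    fin_cases j
    simp
    ring

lemma det_symCongr_diagonal {m : ℕ} (d : Fin m → ℂ) :
    LinearMap.det (symCongr (Matrix.diagonal d)) = (∏ i, d i) ^ (m + 1) := by
  induction m with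
  | zero =>
    have : Subsingleton (symMat 0) := ⟨fun a b => Subtype.ext (Subsingleton.elim _ _)⟩
    simp [LinearMap.det_eq_one_of_subsingleton]
  | succ m ih =>
    have h : symCongr (Matrix.diagonal d) = (symBorder m : _ →ₗ[ℂ] symMat (m + 1)) ∘ₗ
        (((symCongr (Matrix.diagonal fun i => d (Fin.castAdd 1 i))).prodMap
          (Matrix.toLin' (Matrix.diagonal fun i => d (Fin.castAdd 1 i) * d (Fin.natAdd m 0)))).prodMap
          ((d (Fin.natAdd m 0) ^ 2) • (LinearMap.id : ℂ →ₗ[ℂ] ℂ))) ∘ₗ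
        ((symBorder m).symm : symMat (m + 1) →ₗ[ℂ] _) := by
      refine LinearMap.ext fun Z => ?_
      obtain ⟨⟨⟨S, b⟩, t⟩, rfl⟩ := (symBorder m).surjective Z
      rw [symCongr_diagonal_symBorder]
      simp
    rw [h, LinearMap.det_conj, LinearMap.det_prodMap, LinearMap.det_prodMap, ih,
      LinearMap.det_toLin', Matrix.det_diagonal, LinearMap.det_smul, LinearMap.det_id,
      Finset.prod_mul_distrib, Fin.prod_univ_castSucc]
    simp only [Finset.prod_const, Finset.card_univ, Fintype.card_fin, Module.finrank_self, pow_one,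
      mul_one]
    change (∏ i : Fin m, d i.castSucc) ^ (m + 1) *
      ((∏ i : Fin m, d i.castSucc) * d (Fin.last m) ^ m)
      * d (Fin.last m) ^ 2 = _
    ring

lemma det_symCongr {m : ℕ} (A : Matrix (Fin m) (Fin m) ℂ) (hA : A.det ≠ 0) :
    LinearMap.det (symCongr A) = A.det ^ (m + 1) := by
  refine Matrix.diagonal_transvection_induction_of_det_ne_zero
    (fun A => LinearMap.det (symCongr A) = A.det ^ (m + 1)) A hA ?_ ?_ ?_
  · intro D _
    rw [det_symCongr_diagonal, Matrix.det_diagonal]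
  · rintro ⟨i, j, hij, c⟩
    have hone : Matrix.det (Matrix.transvection i j c) = 1 :=
      Matrix.det_transvection_of_ne i j hij c
    rw [Matrix.TransvectionStruct.toMatrix, hone, one_pow]
    set T := Matrix.transvection i j (c / 2) with hT
    have hTT : Matrix.transvection i j c = T * T := by
      rw [hT, Matrix.transvection_mul_transvection_same i j hij, add_halves]
    set d : Fin m → ℂ := Function.update 1 i 2 with hd
    have hd0 : ∀ k, d k ≠ 0 := fun k => by
      rw [hd]
      by_cases h : k = i
      · subst h
        simp
      · simp [h]
    have hDD : Matrix.diagonal d * Matrix.diagonal (fun k => (d k)⁻¹) = 1 := by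
      rw [Matrix.diagonal_mul_diagonal]
      simp [hd0]
    have hconj : T * T = Matrix.diagonal d * T * Matrix.diagonal (fun k => (d k)⁻¹) := by
      rw [← hTT, hT, Matrix.transvection, Matrix.transvection, Matrix.mul_add, Matrix.add_mul,
        Matrix.mul_one, hDD]
      congr 1
      ext k l
      rw [Matrix.mul_diagonal, Matrix.diagonal_mul, Matrix.single_apply, Matrix.single_apply]
      split_ifs with h
      · obtain ⟨rfl, rfl⟩ := h
        simp [hd, hij.symm]
        ring
      · simp
    have hχ : LinearMap.det (symCongr T) * LinearMap.det (symCongr T) =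
        LinearMap.det (symCongr T) := by
      rw [← map_mul, ← symCongr_mul, hconj, symCongr_mul, symCongr_mul, map_mul, map_mul,
        mul_right_comm, ← map_mul, ← symCongr_mul, hDD, symCongr_one, map_one, one_mul]
    have hne : LinearMap.det (symCongr T) ≠ 0 := by
      have hinv : T * Matrix.transvection i j (-(c / 2)) = 1 := by
        rw [hT, Matrix.transvection_mul_transvection_same i j hij, add_neg_cancel,
          Matrix.transvection_zero]
      intro h0
      have := congrArg (fun X => LinearMap.det (symCongr X)) hinv
      simp [symCongr_mul, symCongr_one, h0] at this
    rw [hTT, symCongr_mul, map_mul, hχ]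
    exact mul_left_cancel₀ hne (by rw [hχ, mul_one])
  · intro A B _ _ hA hB
    rw [symCongr_mul, map_mul, hA, hB, Matrix.det_mul, mul_pow]

/-- The absolute value of the real determinant of `S ↦ A S Aᵀ`. -/
lemma abs_det_symCongr_restrictScalars {m : ℕ} (A : Matrix (Fin m) (Fin m) ℂ) (hA : A.det ≠ 0) :
    |LinearMap.det ((symCongr A).restrictScalars ℝ)| = ‖A.det‖ ^ (2 * (m + 1)) := by
  rw [LinearMap.det_restrictScalars, det_symCongr A hA, Algebra.norm_complex_apply,
    Complex.normSq_eq_norm_sq, norm_pow, ← pow_mul, abs_of_nonneg (by positivity), mul_comm]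

lemma lintegral_mul_sq_sub_rpow_le {a : ℝ} (ha : a < 1) {ρ : ℝ} (hρ0 : 0 < ρ) (hρ : ρ ≤ 1) :
    ∫⁻ r in Set.Ioo 0 ρ, ENNReal.ofReal (r * (ρ ^ 2 - r ^ 2) ^ (-a)) ≤
      ENNReal.ofReal (1 / (2 * (1 - a))) := by
  have h1a : 0 < 1 - a := by linarith
  set G : ℝ → ℝ := fun r => -((ρ ^ 2 - r ^ 2) ^ (1 - a) / (2 * (1 - a))) with hG
  have hpos : ∀ r ∈ Set.Ioo 0 ρ, 0 < ρ ^ 2 - r ^ 2 := fun r hr => by nlinarith [hr.1, hr.2]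
  have hcont : ContinuousOn G (Set.Icc 0 ρ) := by
    refine Continuous.continuousOn ?_
    refine ((Continuous.rpow_const (by fun_prop) fun _ => Or.inr h1a.le).div_const _).neg
  have hderiv : ∀ r ∈ Set.Ioo 0 ρ, HasDerivAt G (r * (ρ ^ 2 - r ^ 2) ^ (-a)) r := by
    intro r hr
    have h1 : HasDerivAt (fun r : ℝ => ρ ^ 2 - r ^ 2) (-(2 * r)) r := by
      simpa using (hasDerivAt_pow 2 r).const_sub (ρ ^ 2)
    have h2 := ((h1.rpow_const (p := 1 - a) (Or.inl (hpos r hr).ne')).div_const (2 * (1 - a))).neg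
    refine h2.congr_deriv ?_
    rw [show 1 - a - 1 = -a by ring]
    field_simp
  have hnn : ∀ r ∈ Set.Ioo 0 ρ, 0 ≤ r * (ρ ^ 2 - r ^ 2) ^ (-a) := fun r hr =>
    mul_nonneg hr.1.le (Real.rpow_nonneg (hpos r hr).le _)
  have hint := intervalIntegral.integrableOn_deriv_of_nonneg hcont hderiv hnn
  have hint' : IntervalIntegrable (fun r => r * (ρ ^ 2 - r ^ 2) ^ (-a)) volume 0 ρ :=
    (intervalIntegrable_iff_integrableOn_Ioc_of_le hρ0.le).2 hint
  have hval := intervalIntegral.integral_eq_sub_of_hasDerivAt_of_le hρ0.le hcont hderiv hint'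
  rw [intervalIntegral.integral_of_le hρ0.le, integral_Ioc_eq_integral_Ioo] at hval
  rw [← ofReal_integral_eq_lintegral_ofReal (hint.mono_set Set.Ioo_subset_Ioc_self)
    ((ae_restrict_iff' measurableSet_Ioo).2 (Eventually.of_forall hnn)), hval]
  refine ENNReal.ofReal_le_ofReal ?_
  simp only [hG, sub_self, ne_eq, OfNat.ofNat_ne_zero, not_false_eq_true, zero_pow, sub_zero,
    Real.zero_rpow h1a.ne', zero_div, neg_zero, sub_neg_eq_add, zero_add]
  gcongr
  exact Real.rpow_le_one (by positivity) (pow_le_one₀ hρ0.le hρ) h1a.le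

lemma lintegral_disc_sq_sub_rpow_le {a : ℝ} (ha : a < 1) (c : ℂ) {ρ : ℝ} (hρ0 : 0 < ρ)
    (hρ : ρ ≤ 1) :
    ∫⁻ t : ℂ, (if ‖t - c‖ < ρ then ENNReal.ofReal ((ρ ^ 2 - ‖t - c‖ ^ 2) ^ (-a)) else 0) ≤
      ENNReal.ofReal (2 * Real.pi) * ENNReal.ofReal (1 / (2 * (1 - a))) := by
  rw [lintegral_sub_right_eq_self
    (fun t : ℂ => if ‖t‖ < ρ then ENNReal.ofReal ((ρ ^ 2 - ‖t‖ ^ 2) ^ (-a)) else 0) c,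
    ← Complex.lintegral_comp_polarCoord_symm]
  have hset : polarCoord.target = Set.Ioi (0 : ℝ) ×ˢ Set.Ioo (-Real.pi) Real.pi := rfl
  rw [hset, Measure.volume_eq_prod, ← Measure.prod_restrict]
  refine (lintegral_prod_le _).trans ?_
  simp only [Complex.norm_polarCoord_symm, lintegral_const, Measure.restrict_apply_univ,
    Real.volume_Ioo, sub_neg_eq_add, ← two_mul]
  rw [lintegral_mul_const' _ _ ENNReal.ofReal_ne_top, mul_comm]
  gcongr
  refine le_trans ?_ (lintegral_mul_sq_sub_rpow_le ha hρ0 hρ)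
  rw [← lintegral_indicator measurableSet_Ioi, ← lintegral_indicator measurableSet_Ioo]
  refine lintegral_mono fun r => ?_
  by_cases hr : 0 < r
  · rw [Set.indicator_of_mem (Set.mem_Ioi.2 hr), abs_of_pos hr]
    split_ifs with h
    · rw [Set.indicator_of_mem (Set.mem_Ioo.2 ⟨hr, h⟩), smul_eq_mul, ← ENNReal.ofReal_mul hr.le]
    · simp
  · rw [Set.indicator_of_notMem (by simpa using hr)]
    exact zero_le

section Disk

open scoped ComplexOrder

open Classical in
/-- The function `det(1 - Z* Z)^{-a}` on the generalized unit disk, extended by zero. -/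
def diskWeight {m : ℕ} (a : ℝ) (Z : symMat m) : ENNReal :=
  if (1 - Z.1ᴴ * Z.1).PosDef then ENNReal.ofReal ((1 - Z.1ᴴ * Z.1).det.re ^ (-a)) else 0

lemma one_sub_symBorder {m : ℕ} (S : symMat m) (b : Fin m → ℂ) (t : ℂ) :
    1 - (symBorder m ((S, b), t)).1ᴴ * (symBorder m ((S, b), t)).1 =
      (Matrix.fromBlocks (1 - S.1ᴴ * S.1 - Matrix.replicateCol (Fin 1) (star b) *
          Matrix.replicateRow (Fin 1) b)
        (Matrix.replicateCol (Fin 1) (-(S.1ᴴ *ᵥ b + t • star b)))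
        (Matrix.replicateRow (Fin 1) (star (-(S.1ᴴ *ᵥ b + t • star b))))
        (Matrix.of fun _ _ => 1 - star b ⬝ᵥ b - star t * t)).reindex
          finSumFinEquiv finSumFinEquiv := by
  have h1 : (1 : Matrix (Fin (m + 1)) (Fin (m + 1)) ℂ) =
      (1 : Matrix (Fin m ⊕ Fin 1) (Fin m ⊕ Fin 1) ℂ).reindex finSumFinEquiv finSumFinEquiv := by
    simp
  have h2 : ∀ A B : Matrix (Fin m ⊕ Fin 1) (Fin m ⊕ Fin 1) ℂ,
      A.submatrix finSumFinEquiv.symm finSumFinEquiv.symm -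
        B.submatrix finSumFinEquiv.symm finSumFinEquiv.symm =
      (A - B).submatrix finSumFinEquiv.symm finSumFinEquiv.symm := fun _ _ => rfl
  rw [symBorder_coe, h1, Matrix.reindex_apply, Matrix.reindex_apply, Matrix.reindex_apply,
    Matrix.conjTranspose_submatrix, Matrix.submatrix_mul_equiv, h2,
    Matrix.fromBlocks_conjTranspose, Matrix.fromBlocks_multiply, ← Matrix.fromBlocks_one,
    sub_eq_add_neg (Matrix.fromBlocks _ _ _ _), Matrix.fromBlocks_neg, Matrix.fromBlocks_add]
  congr 1
  congr 1
  · rw [Matrix.conjTranspose_replicateRow]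
    abel
  · ext i j
    simp [Matrix.mul_apply, mulVec, dotProduct, mul_comm]
  · ext i j
    simp [Matrix.mul_apply, mulVec, dotProduct, mul_comm]
  · ext i j
    simp [Matrix.mul_apply, dotProduct, mul_comm, Subsingleton.elim i j]
    ring

lemma mul_sq_sub_normSq {F E : ℝ} (hF : 0 < F) (G t : ℂ) :
    E - F * ‖t‖ ^ 2 - 2 * (t * G).re =
      F * ((E / F + ‖G‖ ^ 2 / F ^ 2) - ‖t - (-(star G) / F)‖ ^ 2) := by
  simp only [← Complex.normSq_eq_norm_sq, Complex.normSq_apply]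
  simp
  field_simp
  ring

lemma exists_disc_of_posDef {m : ℕ} (S : symMat m) (b : Fin m → ℂ) (t₀ : ℂ)
    (h₀ : (1 - (symBorder m ((S, b), t₀)).1ᴴ * (symBorder m ((S, b), t₀)).1).PosDef) :
    (∀ j, ‖b j‖ ≤ 1) ∧ (1 - S.1ᴴ * S.1).PosDef ∧ ∃ (c : ℂ) (ρ : ℝ), 0 < ρ ∧ ρ ≤ 1 ∧
      ∀ t, (1 - (symBorder m ((S, b), t)).1ᴴ * (symBorder m ((S, b), t)).1).PosDef →
        ‖t - c‖ < ρ ∧ (1 - (symBorder m ((S, b), t)).1ᴴ * (symBorder m ((S, b), t)).1).det.re =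
          (1 - S.1ᴴ * S.1).det.re * (ρ ^ 2 - ‖t - c‖ ^ 2) := by
  set P : Matrix (Fin m) (Fin m) ℂ := 1 - S.1ᴴ * S.1 - Matrix.replicateCol (Fin 1) (star b) *
          Matrix.replicateRow (Fin 1) b with hP
  have hsum : 1 - S.1ᴴ * S.1 = P + Matrix.replicateCol (Fin 1) (star b) *
          Matrix.replicateRow (Fin 1) b := by
    rw [hP, sub_add_cancel]
  have hPpos : P.PosDef := by
    have := h₀.submatrix (e := Fin.castAdd 1) (Fin.castAdd_injective m 1)
    rw [one_sub_symBorder] at this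
    convert this using 1
    ext i j
    simp only [Matrix.submatrix_apply, Matrix.reindex_apply, finSumFinEquiv_symm_apply_castAdd,
        Matrix.fromBlocks_apply₁₁]
    rfl
  have hdiag : 0 < 1 - star b ⬝ᵥ b - star t₀ * t₀ := by
    have := h₀.diag_pos (i := Fin.natAdd m 0)
    rw [one_sub_symBorder] at this
    simpa only [Matrix.submatrix_apply, Matrix.reindex_apply, finSumFinEquiv_symm_apply_natAdd,
        Matrix.fromBlocks_apply₂₂, Matrix.of_apply] using this
  have hbb : star b ⬝ᵥ b = ((∑ j, ‖b j‖ ^ 2 : ℝ) : ℂ) := by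
    simp [dotProduct, Complex.conj_mul']
  have hb1 : ∑ j, ‖b j‖ ^ 2 ≤ 1 := by
    have h1 : star t₀ * t₀ = ((‖t₀‖ ^ 2 : ℝ) : ℂ) := by simp [Complex.conj_mul']
    rw [hbb, h1] at hdiag
    have h2 : 0 < 1 - ∑ j, ‖b j‖ ^ 2 - ‖t₀‖ ^ 2 := by exact_mod_cast hdiag
    nlinarith [sq_nonneg ‖t₀‖]
  have hrank :
      (Matrix.replicateCol (Fin 1) (star b) * Matrix.replicateRow (Fin 1) b).PosSemidef := by
    have := Matrix.posSemidef_conjTranspose_mul_self (Matrix.replicateRow (Fin 1) b)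
    rwa [Matrix.conjTranspose_replicateRow] at this
  have hS : (1 - S.1ᴴ * S.1).PosDef := by
    rw [hsum]
    exact hPpos.add_posSemidef hrank
  have hPu : IsUnit P.det := hPpos.det_pos.ne'.isUnit
  have hPinv : P⁻¹.PosDef := hPpos.inv
  have hreal : ∀ u : Fin m → ℂ, ∃ r : ℝ, 0 ≤ r ∧ star u ⬝ᵥ P⁻¹ *ᵥ u = r := by
    intro u
    have h := hPinv.posSemidef.dotProduct_mulVec_nonneg u
    obtain ⟨h1, h2⟩ := Complex.nonneg_iff.1 h
    exact ⟨_, h1, Complex.ext rfl h2.symm⟩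
  obtain ⟨p, hp0, hp⟩ : ∃ p : ℝ, 0 < p ∧ P.det = p := by
    obtain ⟨h1, h2⟩ := Complex.pos_iff.1 hPpos.det_pos
    exact ⟨_, h1, Complex.ext rfl h2.symm⟩
  obtain ⟨h, h0, hh⟩ := hreal (star b)
  obtain ⟨d, d0, hd⟩ := hreal (S.1ᴴ *ᵥ b)
  set G : ℂ := star (S.1ᴴ *ᵥ b) ⬝ᵥ P⁻¹ *ᵥ star b with hG
  have hG' : star (star b) ⬝ᵥ P⁻¹ *ᵥ (S.1ᴴ *ᵥ b) = star G := by
    rw [hG, Matrix.star_dotProduct, Matrix.star_mulVec, hPinv.1.eq, ← Matrix.dotProduct_mulVec]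
  have hF : 0 < 1 + h := by positivity
  set E : ℝ := 1 - ∑ j, ‖b j‖ ^ 2 - d with hE
  have hκ : (1 - S.1ᴴ * S.1).det = ((p * (1 + h) : ℝ) : ℂ) := by
    rw [hsum, Matrix.det_add_mul _ _ hPu, Matrix.det_fin_one, hp]
    have : (Matrix.replicateRow (Fin 1) b * P⁻¹ * Matrix.replicateCol (Fin 1) (star b)) 0 0 =
        star (star b) ⬝ᵥ P⁻¹ *ᵥ star b := by
      rw [Matrix.mul_assoc, ← Matrix.replicateCol_mulVec, Matrix.replicateRow_mul_replicateCol_apply,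
        star_star]
    rw [Matrix.add_apply, this, hh]
    simp
  have hdet : ∀ t, (1 - (symBorder m ((S, b), t)).1ᴴ * (symBorder m ((S, b), t)).1).det =
      ((p * (E - (1 + h) * ‖t‖ ^ 2 - 2 * (t * G).re) : ℝ) : ℂ) := by
    intro t
    have : Invertible P := Matrix.invertibleOfIsUnitDet P hPu
    rw [one_sub_symBorder, ← hP, Matrix.det_reindex_self, Matrix.det_fromBlocks₁₁, hp,
      Matrix.det_fin_one, Matrix.sub_apply, Matrix.mul_assoc, Matrix.invOf_eq_nonsing_inv,
      ← Matrix.replicateCol_mulVec, Matrix.replicateRow_mul_replicateCol_apply, Matrix.of_apply,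
      hbb]
    have e1 : star (-(S.1ᴴ *ᵥ b + t • star b)) ⬝ᵥ P⁻¹ *ᵥ (-(S.1ᴴ *ᵥ b + t • star b)) =
        d + t * G + star t * star G + star t * t * h := by
      rw [star_neg, star_add, star_smul, Matrix.mulVec_neg, neg_dotProduct_neg, Matrix.mulVec_add,
        Matrix.mulVec_smul, dotProduct_add, add_dotProduct, add_dotProduct, smul_dotProduct,
        dotProduct_smul, dotProduct_smul, smul_dotProduct, hd, hh, ← hG, hG']
      simp only [smul_eq_mul]
      ring
    have e2 : t * G + star t * star G = ((2 * (t * G).re : ℝ) : ℂ) := by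
      rw [← star_mul', Complex.star_def, Complex.add_conj]
    have e3 : star t * t = ((‖t‖ ^ 2 : ℝ) : ℂ) := by simp [Complex.conj_mul']
    rw [e1, add_assoc (d : ℂ), e2, e3]
    push_cast [hE]
    ring
  set c : ℂ := -(star G) / ((1 + h : ℝ) : ℂ) with hc
  set R : ℝ := E / (1 + h) + ‖G‖ ^ 2 / (1 + h) ^ 2 with hR
  have hq : ∀ t : ℂ, E - (1 + h) * ‖t‖ ^ 2 - 2 * (t * G).re = (1 + h) * (R - ‖t - c‖ ^ 2) :=
    fun t => mul_sq_sub_normSq hF G t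
  have hlt : ∀ t, (1 - (symBorder m ((S, b), t)).1ᴴ * (symBorder m ((S, b), t)).1).PosDef →
      ‖t - c‖ ^ 2 < R := by
    intro t ht
    have h1 := ht.det_pos
    rw [hdet, hq] at h1
    have h2 : 0 < p * ((1 + h) * (R - ‖t - c‖ ^ 2)) := by exact_mod_cast h1
    have h3 := pos_of_mul_pos_right (pos_of_mul_pos_right h2 hp0.le) hF.le
    linarith
  have hR0 : 0 < R := (sq_nonneg _).trans_lt (hlt t₀ h₀)
  have hR1 : R ≤ 1 := by
    obtain ⟨r, hr0, hr⟩ := hreal (S.1ᴴ *ᵥ b + c • star b)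
    have e1 : star (S.1ᴴ *ᵥ b + c • star b) ⬝ᵥ P⁻¹ *ᵥ (S.1ᴴ *ᵥ b + c • star b) =
        ((d + 2 * (c * G).re + ‖c‖ ^ 2 * h : ℝ) : ℂ) := by
      have e2 : c * G + star c * star G = ((2 * (c * G).re : ℝ) : ℂ) := by
        rw [← star_mul', Complex.star_def, Complex.add_conj]
      have e3 : star c * c = ((‖c‖ ^ 2 : ℝ) : ℂ) := by simp [Complex.conj_mul']
      rw [star_add, star_smul, Matrix.mulVec_add,
        Matrix.mulVec_smul, dotProduct_add, add_dotProduct, add_dotProduct, smul_dotProduct,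
        dotProduct_smul, dotProduct_smul, smul_dotProduct, hd, hh, ← hG, hG']
      push_cast at e2 e3 ⊢
      rw [← e2, ← e3]
      simp only [smul_eq_mul]
      ring
    rw [e1] at hr
    have hr' : d + 2 * (c * G).re + ‖c‖ ^ 2 * h = r := by exact_mod_cast hr
    have h1 := hq c
    rw [sub_self, norm_zero] at h1
    have h2 : (1 + h) * R ≤ 1 := by
      have : 0 ≤ ∑ j, ‖b j‖ ^ 2 := Finset.sum_nonneg fun _ _ => sq_nonneg _
      nlinarith [sq_nonneg ‖c‖]
    nlinarith
  refine ⟨fun j => ?_, hS, c, √R, Real.sqrt_pos.2 hR0, Real.sqrt_le_one.2 hR1, fun t ht => ⟨?_, ?_⟩⟩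
  · have h1 : ‖b j‖ ^ 2 ≤ ∑ j, ‖b j‖ ^ 2 :=
      Finset.single_le_sum (f := fun j => ‖b j‖ ^ 2) (fun _ _ => sq_nonneg _) (Finset.mem_univ j)
    nlinarith [norm_nonneg (b j)]
  · exact Real.lt_sqrt_of_sq_lt (hlt t ht)
  · rw [hdet, hκ, hq, Real.sq_sqrt hR0.le, Complex.ofReal_re, Complex.ofReal_re, mul_assoc]

end Disk

section Haar

open scoped ComplexOrder

instance symMatMeasurableSpace (m : ℕ) : MeasurableSpace (symMat m) := borel _

instance symMatBorelSpace (m : ℕ) : BorelSpace (symMat m) := ⟨rfl⟩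

instance symMatSecondCountable (m : ℕ) : SecondCountableTopology (symMat m) :=
  haveI : SecondCountableTopology (Matrix (Fin m) (Fin m) ℂ) :=
    inferInstanceAs (SecondCountableTopology (Fin m → Fin m → ℂ))
  TopologicalSpace.Subtype.secondCountableTopology _

lemma lintegral_diskWeight_symBorder_le {m : ℕ} {a : ℝ} (ha : a < 1) (S : symMat m)
    (b : Fin m → ℂ) :
    ∫⁻ t, diskWeight a (symBorder m ((S, b), t)) ≤
      (ENNReal.ofReal (2 * Real.pi) * ENNReal.ofReal (1 / (2 * (1 - a)))) *
        ((Metric.closedBall (0 : Fin m → ℂ) 1).indicator 1 b * diskWeight a S) := by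
  classical
  by_cases h : ∃ t₀,
      (1 - (symBorder m ((S, b), t₀)).1ᴴ * (symBorder m ((S, b), t₀)).1).PosDef
  · obtain ⟨t₀, h₀⟩ := h
    obtain ⟨hb, hS, c, ρ, hρ0, hρ1, H⟩ := exists_disc_of_posDef S b t₀ h₀
    have hb' : b ∈ Metric.closedBall (0 : Fin m → ℂ) 1 := by
      rw [mem_closedBall_zero_iff]
      exact (pi_norm_le_iff_of_nonneg zero_le_one).2 hb
    have hκ : 0 < (1 - S.1ᴴ * S.1).det.re := (Complex.pos_iff.1 hS.det_pos).1
    have hle : ∀ t, diskWeight a (symBorder m ((S, b), t)) ≤ diskWeight a S *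
        (if ‖t - c‖ < ρ then ENNReal.ofReal ((ρ ^ 2 - ‖t - c‖ ^ 2) ^ (-a)) else 0) := by
      intro t
      rw [diskWeight]
      split_ifs with h1 h2 h3
      · have h4 : 0 ≤ ρ ^ 2 - ‖t - c‖ ^ 2 := by nlinarith [norm_nonneg (t - c)]
        rw [(H t h1).2, diskWeight, if_pos hS, Real.mul_rpow hκ.le h4,
          ENNReal.ofReal_mul (Real.rpow_nonneg hκ.le _)]
      · exact absurd (H t h1).1 h2
      · exact zero_le
      · exact zero_le
    have hfin : diskWeight a S ≠ ⊤ := by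
      rw [diskWeight, if_pos hS]
      exact ENNReal.ofReal_ne_top
    calc ∫⁻ t, diskWeight a (symBorder m ((S, b), t))
        ≤ ∫⁻ t, diskWeight a S *
        (if ‖t - c‖ < ρ then ENNReal.ofReal ((ρ ^ 2 - ‖t - c‖ ^ 2) ^ (-a)) else 0) :=
          lintegral_mono hle
      _ ≤ _ := by
        rw [lintegral_const_mul' _ _ hfin, Set.indicator_of_mem hb', Pi.one_apply, one_mul,
          mul_comm]
        gcongr
        exact lintegral_disc_sq_sub_rpow_le ha c hρ0 hρ1
  · push Not at h
    have : ∀ t, diskWeight a (symBorder m ((S, b), t)) = 0 := fun t => if_neg (h t)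
    simp [this]

/-- For `a < 1` the function `det(1 - Z* Z)^{-a}` is integrable over the generalized disk. -/
lemma exists_haar_lintegral_diskWeight_lt_top (m : ℕ) {a : ℝ} (ha : a < 1) :
    ∃ μ : Measure (symMat m), μ.IsAddHaarMeasure ∧ SFinite μ ∧ ∫⁻ Z, diskWeight a Z ∂μ < ⊤ := by
  induction m with
  | zero =>
    have hsub : Subsingleton (symMat 0) := ⟨fun a b => Subtype.ext (Subsingleton.elim _ _)⟩
    refine ⟨Measure.addHaar, inferInstance, inferInstance, ?_⟩
    have hle : ∀ Z : symMat 0, diskWeight a Z ≤ 1 := by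
      intro Z
      rw [diskWeight]
      split_ifs
      · simp
      · exact zero_le
    calc ∫⁻ Z : symMat 0, diskWeight a Z ∂Measure.addHaar
        ≤ ∫⁻ _ : symMat 0, 1 ∂Measure.addHaar := lintegral_mono hle
      _ = Measure.addHaar (Set.univ : Set (symMat 0)) := by rw [lintegral_one]
      _ < ⊤ := (Set.toFinite _).isCompact.measure_lt_top
  | succ m ih =>
    obtain ⟨μ, hμ, hμs, hfin⟩ := ih
    have c1 : Continuous (symBorder m) :=
      (symBorder m).toLinearMap.continuous_of_finiteDimensional
    have c2 : Continuous (symBorder m).symm :=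
      (symBorder m).symm.toLinearMap.continuous_of_finiteDimensional
    have h1 : (μ.prod (volume : Measure (Fin m → ℂ))).IsAddHaarMeasure :=
      Measure.prod.instIsAddHaarMeasure μ volume
    have h2 : ((μ.prod (volume : Measure (Fin m → ℂ))).prod
        (volume : Measure ℂ)).IsAddHaarMeasure :=
      Measure.prod.instIsAddHaarMeasure _ volume
    refine ⟨Measure.map (symBorder m) ((μ.prod volume).prod volume),
      AddEquiv.isAddHaarMeasure_map _ (symBorder m).toAddEquiv c1 c2, inferInstance, ?_⟩
    refine (lintegral_map_le _ _).trans_lt ?_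
    refine (lintegral_prod_le (μ := μ.prod (volume : Measure (Fin m → ℂ)))
      (ν := (volume : Measure ℂ)) (fun p => diskWeight a (symBorder m p))).trans_lt ?_
    set k : ENNReal := ENNReal.ofReal (2 * Real.pi) * ENNReal.ofReal (1 / (2 * (1 - a))) with hk
    have hkt : k < ⊤ := ENNReal.mul_lt_top ENNReal.ofReal_lt_top ENNReal.ofReal_lt_top
    have hmono : ∫⁻ p : symMat m × (Fin m → ℂ), ∫⁻ t : ℂ, diskWeight a (symBorder m (p, t))
          ∂(volume : Measure ℂ) ∂(μ.prod (volume : Measure (Fin m → ℂ))) ≤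
        ∫⁻ p : symMat m × (Fin m → ℂ),
          k * ((Metric.closedBall (0 : Fin m → ℂ) 1).indicator 1 p.2 * diskWeight a p.1)
          ∂(μ.prod (volume : Measure (Fin m → ℂ))) :=
      lintegral_mono fun p => lintegral_diskWeight_symBorder_le ha p.1 p.2
    refine hmono.trans_lt ?_
    rw [lintegral_const_mul' _ _ hkt.ne]
    refine ENNReal.mul_lt_top hkt ?_
    refine (lintegral_prod_le (μ := μ) (ν := (volume : Measure (Fin m → ℂ))) (fun p =>
      (Metric.closedBall (0 : Fin m → ℂ) 1).indicator 1 p.2 * diskWeight a p.1)).trans_lt ?_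
    have hin : ∀ S : symMat m, ∫⁻ b : Fin m → ℂ,
        (Metric.closedBall (0 : Fin m → ℂ) 1).indicator 1 b * diskWeight a S =
        volume (Metric.closedBall (0 : Fin m → ℂ) 1) * diskWeight a S := by
      intro S
      rw [lintegral_mul_const _ (measurable_one.indicator measurableSet_closedBall),
        lintegral_indicator_one measurableSet_closedBall]
    simp only [hin]
    have hball : volume (Metric.closedBall (0 : Fin m → ℂ) 1) < ⊤ :=
      (isCompact_closedBall _ _).measure_lt_top
    rw [lintegral_const_mul' _ _ hball.ne]
    exact ENNReal.mul_lt_top hball hfin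

end Haar

/-- The Cayley matrix conjugating `Sp_m(ℝ)` into the group preserving the unit disk. -/
def cayleyMat (m : ℕ) : Matrix (Fin m ⊕ Fin m) (Fin m ⊕ Fin m) ℂ :=
  Matrix.fromBlocks 1 (-Complex.I • 1) 1 (Complex.I • 1)

/-- The inverse of the Cayley matrix. -/
def cayleyInv (m : ℕ) : Matrix (Fin m ⊕ Fin m) (Fin m ⊕ Fin m) ℂ :=
  Matrix.fromBlocks ((1 / 2 : ℂ) • 1) ((1 / 2 : ℂ) • 1)
    ((Complex.I / 2) • 1) (-(Complex.I / 2) • 1)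

lemma cayleyInv_mul (m : ℕ) : cayleyInv m * cayleyMat m = 1 := by
  rw [cayleyInv, cayleyMat, Matrix.fromBlocks_multiply, ← Matrix.fromBlocks_one]
  congr 1 <;>
  · simp only [smul_mul_assoc, one_mul, smul_smul, ← add_smul]
    ring_nf
    simp

/-- The signature matrix `diag(1, -1)`. -/
def signMat (m : ℕ) : Matrix (Fin m ⊕ Fin m) (Fin m ⊕ Fin m) ℂ := Matrix.fromBlocks 1 0 0 (-1)

lemma signMat_mul_self (m : ℕ) : signMat m * signMat m = 1 := by
  simp [signMat, Matrix.fromBlocks_multiply]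

lemma cayleyMat_signMat (m : ℕ) : (cayleyMat m)ᴴ * signMat m * cayleyMat m =
    (2 * Complex.I) • (Wmat m).map Complex.ofReal := by
  simp only [cayleyMat, signMat, Wmat, Matrix.fromBlocks_conjTranspose, Matrix.fromBlocks_multiply,
    Matrix.fromBlocks_map, Matrix.fromBlocks_smul]
  congr 1
  · simp
  · ext i j
    by_cases h : i = j <;> simp [h]; ring
  · ext i j
    by_cases h : i = j <;> simp [h]; ring
  · simp

/-- The image of a real matrix under conjugation by the Cayley matrix. -/
def cayley {m : ℕ} (h : Matrix (Fin m ⊕ Fin m) (Fin m ⊕ Fin m) ℝ) :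
    Matrix (Fin m ⊕ Fin m) (Fin m ⊕ Fin m) ℂ :=
  cayleyMat m * h.map Complex.ofReal * cayleyInv m

/-- The upper left block of the Cayley transform of a real matrix. -/
def cayA {m : ℕ} (h : Matrix (Fin m ⊕ Fin m) (Fin m ⊕ Fin m) ℝ) : Matrix (Fin m) (Fin m) ℂ :=
  (1 / 2 : ℂ) • (cmat h.toBlocks₁₁ + cmat h.toBlocks₂₂ +
    Complex.I • (cmat h.toBlocks₁₂ - cmat h.toBlocks₂₁))

/-- The upper right block of the Cayley transform of a real matrix. -/
def cayB {m : ℕ} (h : Matrix (Fin m ⊕ Fin m) (Fin m ⊕ Fin m) ℝ) : Matrix (Fin m) (Fin m) ℂ :=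
  (1 / 2 : ℂ) • (cmat h.toBlocks₁₁ - cmat h.toBlocks₂₂ -
    Complex.I • (cmat h.toBlocks₁₂ + cmat h.toBlocks₂₁))

lemma map_ofReal_mul {ι : Type*} [Fintype ι] (A B : Matrix ι ι ℝ) :
    (A * B).map Complex.ofReal = A.map Complex.ofReal * B.map Complex.ofReal :=
  Matrix.map_mul (f := Complex.ofRealHom)

lemma cayley_mul {m : ℕ} (g h : Matrix (Fin m ⊕ Fin m) (Fin m ⊕ Fin m) ℝ) :
    cayley (g * h) = cayley g * cayley h := by
  have : cayley g * cayley h = cayleyMat m * g.map Complex.ofReal *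
      (cayleyInv m * cayleyMat m) * h.map Complex.ofReal * cayleyInv m := by
    simp only [cayley, Matrix.mul_assoc]
  rw [this, cayleyInv_mul, Matrix.mul_one, cayley, map_ofReal_mul]
  simp only [Matrix.mul_assoc]

lemma cayley_eq {m : ℕ} (h : Matrix (Fin m ⊕ Fin m) (Fin m ⊕ Fin m) ℝ) :
    cayley h = Matrix.fromBlocks (cayA h) (cayB h) (cayB h)ᴴᵀ (cayA h)ᴴᵀ := by
  rw [cayley, ← Matrix.fromBlocks_toBlocks (h.map Complex.ofReal), cayleyMat, cayleyInv,
    Matrix.fromBlocks_multiply, Matrix.fromBlocks_multiply]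
  congr 1 <;>
  · ext i j
    simp [cayA, cayB, cmat, Matrix.toBlocks₁₁, Matrix.toBlocks₁₂, Matrix.toBlocks₂₁,
      Matrix.toBlocks₂₂]
    ring_nf
    simp only [Complex.I_sq]
    ring

lemma cayley_conjTranspose_mul {m : ℕ} {h : Matrix (Fin m ⊕ Fin m) (Fin m ⊕ Fin m) ℝ}
    (hh : IsSymplectic h) : (cayley h)ᴴ * signMat m * cayley h = signMat m := by
  have hr : (h.map Complex.ofReal)ᴴ = hᵀ.map Complex.ofReal := by
    ext i j
    simp
  have hinv : cayleyMat m * cayleyInv m = 1 := mul_eq_one_comm.1 (cayleyInv_mul m)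
  calc (cayley h)ᴴ * signMat m * cayley h
      = (cayleyInv m)ᴴ * (hᵀ.map Complex.ofReal * ((cayleyMat m)ᴴ * signMat m * cayleyMat m) *
          h.map Complex.ofReal) * cayleyInv m := by
        rw [cayley, Matrix.conjTranspose_mul, Matrix.conjTranspose_mul, hr]
        simp only [Matrix.mul_assoc]
    _ = (cayleyInv m)ᴴ * ((cayleyMat m)ᴴ * signMat m * cayleyMat m) * cayleyInv m := by
        rw [cayleyMat_signMat, Matrix.mul_smul, Matrix.smul_mul, ← map_ofReal_mul,
          ← map_ofReal_mul, hh]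
    _ = (cayleyMat m * cayleyInv m)ᴴ * signMat m * (cayleyMat m * cayleyInv m) := by
        rw [Matrix.conjTranspose_mul]
        simp only [Matrix.mul_assoc]
    _ = signMat m := by rw [hinv]; simp

lemma cayley_mul_conjTranspose {m : ℕ} {h : Matrix (Fin m ⊕ Fin m) (Fin m ⊕ Fin m) ℝ}
    (hh : IsSymplectic h) : cayley h * signMat m * (cayley h)ᴴ = signMat m := by
  have h1 : (signMat m * (cayley h)ᴴ * signMat m) * cayley h = 1 := by
    rw [Matrix.mul_assoc, Matrix.mul_assoc, ← Matrix.mul_assoc (cayley h)ᴴ,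
      cayley_conjTranspose_mul hh, signMat_mul_self]
  have h2 := congrArg (· * signMat m) (mul_eq_one_comm.1 h1)
  simp only [Matrix.mul_assoc, signMat_mul_self, Matrix.mul_one, Matrix.one_mul] at h2
  rw [Matrix.mul_assoc, h2]

/-- The block relations satisfied by the Cayley transform of a symplectic matrix. -/
structure IsPseudoUnitary {m : ℕ} (α β : Matrix (Fin m) (Fin m) ℂ) : Prop where
  left_diag : αᴴ * α - βᵀ * βᴴᵀ = 1
  left_off : αᴴ * β = βᵀ * αᴴᵀ
  right_diag : α * αᴴ - β * βᴴ = 1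
  right_off : α * βᵀ = β * αᵀ

lemma IsSymplectic.isPseudoUnitary {m : ℕ} {h : Matrix (Fin m ⊕ Fin m) (Fin m ⊕ Fin m) ℝ}
    (hh : IsSymplectic h) : IsPseudoUnitary (cayA h) (cayB h) := by
  have h1 := cayley_conjTranspose_mul hh
  have h2 := cayley_mul_conjTranspose hh
  have hc : ∀ A : Matrix (Fin m) (Fin m) ℂ, Aᴴᵀᴴ = Aᵀ := fun A => by
    ext i j
    simp
  simp only [cayley_eq, signMat, Matrix.fromBlocks_conjTranspose, Matrix.fromBlocks_multiply,
    hc, Matrix.fromBlocks_inj, Matrix.mul_one, Matrix.mul_zero, add_zero, zero_add,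
    Matrix.mul_neg, Matrix.neg_mul] at h1 h2
  simp only [← sub_eq_add_neg] at h1 h2
  exact ⟨h1.1, sub_eq_zero.1 h1.2.1, h2.1, sub_eq_zero.1 h2.2.1⟩

lemma cayA_mul {m : ℕ} (g h : Matrix (Fin m ⊕ Fin m) (Fin m ⊕ Fin m) ℝ) :
    cayA (g * h) = cayA g * cayA h + cayB g * (cayB h)ᴴᵀ := by
  have := cayley_mul g h
  rw [cayley_eq, cayley_eq, cayley_eq, Matrix.fromBlocks_multiply, Matrix.fromBlocks_inj] at this
  exact this.1

lemma cayB_mul {m : ℕ} (g h : Matrix (Fin m ⊕ Fin m) (Fin m ⊕ Fin m) ℝ) :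
    cayB (g * h) = cayA g * cayB h + cayB g * (cayA h)ᴴᵀ := by
  have := cayley_mul g h
  rw [cayley_eq, cayley_eq, cayley_eq, Matrix.fromBlocks_multiply, Matrix.fromBlocks_inj] at this
  exact this.2.1

section OperatorNorm

open scoped ComplexOrder MatrixOrder Matrix.Norms.L2Operator

lemma l2_norm_one_le (m : ℕ) : ‖(1 : Matrix (Fin m) (Fin m) ℂ)‖ ≤ 1 := by
  rcases subsingleton_or_nontrivial (Matrix (Fin m) (Fin m) ℂ) with h | h
  · rw [Subsingleton.elim (1 : Matrix (Fin m) (Fin m) ℂ) 0, norm_zero]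
    exact zero_le_one
  · exact CStarRing.norm_one.le

lemma l2_norm_le_one_of_add {m : ℕ} {X P : Matrix (Fin m) (Fin m) ℂ} (h : Xᴴ * X + Pᴴ * P = 1) :
    ‖X‖ ≤ 1 := by
  have h0 : 0 ≤ Xᴴ * X := (posSemidef_conjTranspose_mul_self X).nonneg
  have h1 : Xᴴ * X ≤ 1 := by
    rw [Matrix.le_iff, ← h, add_sub_cancel_left]
    exact posSemidef_conjTranspose_mul_self P
  have h2 := (CStarAlgebra.norm_le_norm_of_nonneg_of_le h0 h1).trans (l2_norm_one_le m)
  rw [Matrix.l2_opNorm_conjTranspose_mul_self] at h2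
  nlinarith [norm_nonneg X]

lemma posDef_one_sub_of_norm_lt_one {m : ℕ} {κ : Matrix (Fin m) (Fin m) ℂ} (h : ‖κ‖ < 1) :
    (1 - κᴴ * κ).PosDef := by
  have h1 : κᴴ * κ ≤ algebraMap ℝ _ (‖κ‖ ^ 2) := CStarAlgebra.star_mul_le_algebraMap_norm_sq
  rw [Matrix.le_iff] at h1
  have h2 : (1 - κᴴ * κ) = (1 - ‖κ‖ ^ 2) • (1 : Matrix (Fin m) (Fin m) ℂ) +
      (algebraMap ℝ _ (‖κ‖ ^ 2) - κᴴ * κ) := by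
    rw [Algebra.algebraMap_eq_smul_one, sub_smul, one_smul]
    abel
  rw [h2]
  exact (Matrix.PosDef.one.smul (by nlinarith [norm_nonneg κ])).add_posSemidef h1

lemma norm_apply_le_l2 {m : ℕ} (A : Matrix (Fin m) (Fin m) ℂ) (i j : Fin m) : ‖A i j‖ ≤ ‖A‖ := by
  have h := Matrix.l2_opNorm_mulVec A (EuclideanSpace.single j 1)
  rw [PiLp.norm_single, norm_one, mul_one] at h
  refine le_trans ?_ h
  refine le_trans (le_of_eq ?_) (PiLp.norm_apply_le _ i)
  simp

lemma norm_det_le_of_norm_apply_le {m : ℕ} {A : Matrix (Fin m) (Fin m) ℂ} {x : ℝ}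
    (h : ∀ i j, ‖A i j‖ ≤ x) : ‖A.det‖ ≤ m.factorial * x ^ m := by
  have := Matrix.det_le (A := A) (abv := NormedField.toAbsoluteValue ℂ) h
  rw [Fintype.card_fin, nsmul_eq_mul] at this
  exact this

end OperatorNorm

section DiskGeometry

open scoped ComplexOrder MatrixOrder Matrix.Norms.L2Operator

namespace IsPseudoUnitary

variable {m : ℕ} {α β : Matrix (Fin m) (Fin m) ℂ}

lemma isUnit_det (h : IsPseudoUnitary α β) : IsUnit α.det := by
  have h1 : (αᴴ * α).PosDef := by
    have : αᴴ * α = 1 + (βᴴᵀ)ᴴ * βᴴᵀ := by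
      rw [← h.left_diag]
      have : (βᴴᵀ)ᴴ = βᵀ := by
        ext i j
        simp
      rw [this]
      abel
    rw [this]
    exact Matrix.PosDef.one.add_posSemidef (posSemidef_conjTranspose_mul_self _)
  have h2 := h1.det_pos.ne'
  rw [Matrix.det_mul] at h2
  exact (right_ne_zero_of_mul h2).isUnit

/-- The matrix `β̄ α⁻¹` is a contraction. -/
lemma norm_conj_mul_inv_le (h : IsPseudoUnitary α β) : ‖βᴴᵀ * α⁻¹‖ ≤ 1 := by
  refine l2_norm_le_one_of_add (P := α⁻¹) ?_
  have hc : (βᴴᵀ)ᴴ = βᵀ := by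
    ext i j
    simp
  have h1 : (βᴴᵀ * α⁻¹)ᴴ * (βᴴᵀ * α⁻¹) + (α⁻¹)ᴴ * α⁻¹ =
      (α⁻¹)ᴴ * (βᵀ * βᴴᵀ + 1) * α⁻¹ := by
    rw [Matrix.conjTranspose_mul, hc]
    noncomm_ring
  have h2 : βᵀ * βᴴᵀ + 1 = αᴴ * α := by
    rw [← h.left_diag]
    abel
  rw [h1, h2, Matrix.conjTranspose_nonsing_inv, ← Matrix.mul_assoc,
    Matrix.nonsing_inv_mul _ (by rw [Matrix.det_conjTranspose]; exact h.isUnit_det.star),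
    Matrix.one_mul, Matrix.mul_nonsing_inv _ h.isUnit_det]

lemma conjugate (h : IsPseudoUnitary α β) : αᴴᵀ * αᵀ - βᴴᵀ * βᵀ = 1 := by
  have := congrArg (fun A : Matrix (Fin m) (Fin m) ℂ => Aᴴᵀ) h.right_diag
  simpa [Matrix.conjTranspose_sub, Matrix.conjTranspose_mul, Matrix.transpose_mul] using this

/-- The matrix `β̄` factors through `ᾱ` by a contraction. -/
lemma exists_contraction (h : IsPseudoUnitary α β) :
    ∃ W : Matrix (Fin m) (Fin m) ℂ, ‖W‖ ≤ 1 ∧ βᴴᵀ = αᴴᵀ * W := by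
  have hu : IsUnit αᴴᵀ.det := by
    rw [Matrix.det_transpose, Matrix.det_conjTranspose]
    exact h.isUnit_det.star
  refine ⟨(αᴴᵀ)⁻¹ * βᴴᵀ, ?_, by rw [← Matrix.mul_assoc, Matrix.mul_nonsing_inv _ hu,
    Matrix.one_mul]⟩
  rw [← Matrix.l2_opNorm_conjTranspose]
  refine l2_norm_le_one_of_add (P := ((αᴴᵀ)⁻¹)ᴴ) ?_
  have hc : ∀ A : Matrix (Fin m) (Fin m) ℂ, Aᴴᵀᴴ = Aᵀ := fun A => by
    ext i j
    simp
  have h2 : βᴴᵀ * βᵀ + 1 = αᴴᵀ * αᵀ := by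
    rw [← h.conjugate]
    abel
  have h1 : ((αᴴᵀ)⁻¹ * βᴴᵀ) * (βᵀ * ((αᴴᵀ)⁻¹)ᴴ) + (αᴴᵀ)⁻¹ * ((αᴴᵀ)⁻¹)ᴴ =
      (αᴴᵀ)⁻¹ * (βᴴᵀ * βᵀ + 1) * ((αᴴᵀ)⁻¹)ᴴ := by noncomm_ring
  have hut : IsUnit αᵀ.det := by
    rw [Matrix.det_transpose]
    exact h.isUnit_det
  rw [Matrix.conjTranspose_conjTranspose, Matrix.conjTranspose_conjTranspose,
    Matrix.conjTranspose_mul, hc, h1, h2, ← Matrix.mul_assoc, Matrix.nonsing_inv_mul _ hu,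
    Matrix.one_mul, Matrix.conjTranspose_nonsing_inv, hc, Matrix.mul_nonsing_inv _ hut]

/-- The action of a pseudo-unitary matrix on a vector `[ζ; 1]` preserves the hermitian form. -/
lemma form_eq (h : IsPseudoUnitary α β) (X Y : Matrix (Fin m) (Fin m) ℂ) :
    (βᴴᵀ * X + αᴴᵀ * Y)ᴴ * (βᴴᵀ * X + αᴴᵀ * Y) - (α * X + β * Y)ᴴ * (α * X + β * Y) =
      Yᴴ * Y - Xᴴ * X := by
  have hc : ∀ A : Matrix (Fin m) (Fin m) ℂ, Aᴴᵀᴴ = Aᵀ := fun A => by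
    ext i j
    simp
  have e1 : βᵀ * βᴴᵀ = αᴴ * α - 1 := by
    rw [← h.left_diag]
    abel
  have e2 : αᵀ * αᴴᵀ = βᴴ * β + 1 := by
    have := congrArg (fun A : Matrix (Fin m) (Fin m) ℂ => Aᵀ) h.left_diag
    simp only [Matrix.transpose_sub, Matrix.transpose_mul, Matrix.transpose_transpose,
      Matrix.transpose_one] at this
    rw [← this]
    abel
  have e3 : αᵀ * βᴴᵀ = βᴴ * α := by
    have h1 := congrArg (fun A : Matrix (Fin m) (Fin m) ℂ => Aᴴ) h.left_off
    have h2 : βᵀᴴ = βᴴᵀ := rfl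
    simp only [Matrix.conjTranspose_mul, Matrix.conjTranspose_conjTranspose, hc, h2] at h1
    exact h1.symm
  have hl : (βᴴᵀ * X + αᴴᵀ * Y)ᴴ * (βᴴᵀ * X + αᴴᵀ * Y) =
      Xᴴ * (βᵀ * βᴴᵀ) * X + Xᴴ * (βᵀ * αᴴᵀ) * Y + Yᴴ * (αᵀ * βᴴᵀ) * X +
        Yᴴ * (αᵀ * αᴴᵀ) * Y := by
    rw [Matrix.conjTranspose_add, Matrix.conjTranspose_mul, Matrix.conjTranspose_mul, hc, hc]
    noncomm_ring
  rw [hl, e1, e2, e3, ← h.left_off, Matrix.conjTranspose_add, Matrix.conjTranspose_mul,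
    Matrix.conjTranspose_mul]
  noncomm_ring

/-- If a pseudo-unitary matrix maps a point of a small disk into a small disk, it is bounded. -/
lemma norm_le_two (h : IsPseudoUnitary α β) {κ κ' : Matrix (Fin m) (Fin m) ℂ} (hκ : ‖κ‖ ≤ 1 / 3)
    (hκ' : ‖κ'‖ ≤ 1 / 3) (he : α * κ + β = κ' * (βᴴᵀ * κ + αᴴᵀ)) :
    ‖αᴴᵀ‖ ≤ 2 ∧ ‖βᴴᵀ‖ ≤ 2 := by
  obtain ⟨W, hW, hβ⟩ := h.exists_contraction
  set Y := βᴴᵀ * κ + αᴴᵀ with hY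
  have hf := h.form_eq κ 1
  rw [Matrix.mul_one, Matrix.mul_one, he, ← hY, Matrix.conjTranspose_one, Matrix.one_mul] at hf
  have hYY : Yᴴ * Y = (κ' * Y)ᴴ * (κ' * Y) + 1 - κᴴ * κ := by
    rw [add_sub_assoc, ← hf]
    abel
  have h1 : ‖Y‖ * ‖Y‖ ≤ ‖κ' * Y‖ * ‖κ' * Y‖ + 1 + ‖κ‖ * ‖κ‖ := by
    rw [← Matrix.l2_opNorm_conjTranspose_mul_self, hYY, ← Matrix.l2_opNorm_conjTranspose_mul_self,
      ← Matrix.l2_opNorm_conjTranspose_mul_self]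
    refine (norm_sub_le _ _).trans (add_le_add ((norm_add_le _ _).trans ?_) le_rfl)
    exact add_le_add le_rfl (l2_norm_one_le m)
  have h2 : ‖κ' * Y‖ ≤ 1 / 3 * ‖Y‖ :=
    (norm_mul_le _ _).trans (mul_le_mul_of_nonneg_right hκ' (norm_nonneg _))
  have h3 : ‖Y‖ ≤ 5 / 4 := by
    nlinarith [norm_nonneg Y, norm_nonneg κ, norm_nonneg (κ' * Y)]
  have h4 : ‖βᴴᵀ‖ ≤ ‖αᴴᵀ‖ := by
    rw [hβ]
    exact (norm_mul_le _ _).trans (mul_le_of_le_one_right (norm_nonneg _) hW)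
  have h5 : ‖αᴴᵀ‖ ≤ ‖Y‖ + ‖βᴴᵀ‖ * ‖κ‖ := by
    have : αᴴᵀ = Y - βᴴᵀ * κ := by
      rw [hY]
      abel
    calc ‖αᴴᵀ‖ = ‖Y - βᴴᵀ * κ‖ := by rw [← this]
      _ ≤ _ := (norm_sub_le _ _).trans (add_le_add le_rfl (norm_mul_le _ _))
  have h6 : ‖αᴴᵀ‖ ≤ 2 := by nlinarith [norm_nonneg (βᴴᵀ), norm_nonneg κ]
  exact ⟨h6, h4.trans h6⟩

end IsPseudoUnitary

/-- A neighbourhood of the point of the disk mapped to the origin by a pseudo-unitary matrix. -/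
def discNbhd {m : ℕ} (α β : Matrix (Fin m) (Fin m) ℂ) : Set (symMat m) :=
  {ζ | ∃ η : symMat m, ‖η.1‖ < 1 / 4 ∧ ζ.1 = α⁻¹ * (η.1 * (α⁻¹)ᵀ - β)}

lemma IsPseudoUnitary.exists_of_mem_discNbhd {m : ℕ} {α β : Matrix (Fin m) (Fin m) ℂ}
    (h : IsPseudoUnitary α β) {ζ : symMat m} (hζ : ζ ∈ discNbhd α β) :
    ∃ κ : Matrix (Fin m) (Fin m) ℂ, ‖κ‖ ≤ 1 / 3 ∧
      α * ζ.1 + β = κ * (βᴴᵀ * ζ.1 + αᴴᵀ) ∧ IsUnit (βᴴᵀ * ζ.1 + αᴴᵀ).det ∧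
      ‖(βᴴᵀ * ζ.1 + αᴴᵀ).det‖ ≤ m.factorial * 2 ^ m * ‖α.det‖⁻¹ := by
  obtain ⟨η, hη, hζη⟩ := hζ
  set W := βᴴᵀ * α⁻¹ with hW
  have hW1 : ‖W‖ ≤ 1 := h.norm_conj_mul_inv_le
  have hWη : ‖W * η.1‖ ≤ 1 / 4 :=
    (norm_mul_le _ _).trans (by nlinarith [norm_nonneg W, norm_nonneg η.1])
  have hα := h.isUnit_det
  have hI : α * ζ.1 + β = η.1 * (α⁻¹)ᵀ := by
    rw [hζη, ← Matrix.mul_assoc, Matrix.mul_nonsing_inv _ hα, Matrix.one_mul]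
    abel
  have hinvT : αᵀ * (α⁻¹)ᵀ = 1 := by
    rw [← Matrix.transpose_mul, Matrix.nonsing_inv_mul _ hα, Matrix.transpose_one]
  have hJ0 : αᴴᵀ - W * β = (α⁻¹)ᵀ := by
    have h1 : (αᴴᵀ - W * β) * αᵀ = 1 := by
      rw [Matrix.sub_mul, Matrix.mul_assoc W, ← h.right_off, hW, Matrix.mul_assoc βᴴᵀ,
        ← Matrix.mul_assoc α⁻¹, Matrix.nonsing_inv_mul _ hα, Matrix.one_mul, h.conjugate]
    calc αᴴᵀ - W * β = (αᴴᵀ - W * β) * (αᵀ * (α⁻¹)ᵀ) := by rw [hinvT, Matrix.mul_one]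
      _ = (α⁻¹)ᵀ := by rw [← Matrix.mul_assoc, h1, Matrix.one_mul]
  have hJ : βᴴᵀ * ζ.1 + αᴴᵀ = (1 + W * η.1) * (α⁻¹)ᵀ := by
    rw [hζη, ← Matrix.mul_assoc, ← hW, Matrix.add_mul, Matrix.one_mul, ← hJ0]
    noncomm_ring
  have hu : IsUnit (1 + W * η.1) := by
    have := isUnit_one_sub_of_norm_lt_one (x := -(W * η.1)) (by rw [norm_neg]; linarith)
    rwa [sub_neg_eq_add] at this
  have hud : IsUnit (1 + W * η.1).det := (Matrix.isUnit_iff_isUnit_det _).1 hu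
  set K := (1 + W * η.1)⁻¹ with hK
  have hK1 : (1 + W * η.1) * K = 1 := Matrix.mul_nonsing_inv _ hud
  have hK2 : K * (1 + W * η.1) = 1 := Matrix.nonsing_inv_mul _ hud
  have hKn : ‖K‖ ≤ 4 / 3 := by
    have h1 : K = 1 - W * η.1 * K := by
      rw [← hK1]
      noncomm_ring
    have h2 : ‖K‖ ≤ 1 + 1 / 4 * ‖K‖ := by
      calc ‖K‖ = ‖1 - W * η.1 * K‖ := by rw [← h1]
        _ ≤ ‖(1 : Matrix (Fin m) (Fin m) ℂ)‖ + ‖W * η.1 * K‖ := norm_sub_le _ _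
        _ ≤ 1 + 1 / 4 * ‖K‖ := add_le_add (l2_norm_one_le m)
          ((norm_mul_le _ _).trans (mul_le_mul_of_nonneg_right hWη (norm_nonneg _)))
    linarith
  refine ⟨η.1 * K, ?_, ?_, ?_, ?_⟩
  · refine (norm_mul_le _ _).trans ?_
    nlinarith [norm_nonneg K, norm_nonneg η.1]
  · rw [hI, hJ, Matrix.mul_assoc, ← Matrix.mul_assoc K, hK2, Matrix.one_mul]
  · rw [hJ, Matrix.det_mul, Matrix.det_transpose]
    exact hud.mul ((Matrix.isUnit_nonsing_inv_det_iff).2 hα)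
  · rw [hJ, Matrix.det_mul, Matrix.det_transpose, norm_mul, Matrix.det_nonsing_inv,
      Ring.inverse_eq_inv', norm_inv]
    refine mul_le_mul_of_nonneg_right ?_ (by positivity)
    refine norm_det_le_of_norm_apply_le fun i j => (norm_apply_le_l2 _ i j).trans ?_
    refine (norm_add_le _ _).trans ?_
    linarith [l2_norm_one_le m]

/-- The function `det(1 - ζ* ζ)` is bounded on `discNbhd α β` by a multiple of `|det α|⁻²`. -/
lemma IsPseudoUnitary.det_le_of_mem_discNbhd {m : ℕ} {α β : Matrix (Fin m) (Fin m) ℂ}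
    (h : IsPseudoUnitary α β) {ζ : symMat m} (hζ : ζ ∈ discNbhd α β) :
    (1 - ζ.1ᴴ * ζ.1).PosDef ∧
      (1 - ζ.1ᴴ * ζ.1).det.re ≤ (m.factorial * 2 ^ m) ^ 3 * (‖α.det‖⁻¹) ^ 2 := by
  obtain ⟨κ, hκ, he, hu, hd⟩ := h.exists_of_mem_discNbhd hζ
  set J := βᴴᵀ * ζ.1 + αᴴᵀ with hJ
  have hf := h.form_eq ζ.1 1
  rw [Matrix.mul_one, Matrix.mul_one, he, ← hJ, Matrix.conjTranspose_one, Matrix.one_mul] at hf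
  have hform : 1 - ζ.1ᴴ * ζ.1 = Jᴴ * (1 - κᴴ * κ) * J := by
    rw [← hf, Matrix.conjTranspose_mul]
    noncomm_ring
  have hpd := posDef_one_sub_of_norm_lt_one (hκ.trans_lt (by norm_num : (1 / 3 : ℝ) < 1))
  have hdet : ‖(1 - κᴴ * κ).det‖ ≤ m.factorial * 2 ^ m := by
    refine norm_det_le_of_norm_apply_le fun i j => (norm_apply_le_l2 _ i j).trans ?_
    refine (norm_sub_le _ _).trans ?_
    rw [Matrix.l2_opNorm_conjTranspose_mul_self]
    nlinarith [l2_norm_one_le m, norm_nonneg κ]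
  rw [hform]
  refine ⟨hpd.conjTranspose_mul_mul_same (Matrix.mulVec_injective_of_isUnit
    ((Matrix.isUnit_iff_isUnit_det _).2 hu)), (Complex.re_le_norm _).trans ?_⟩
  rw [Matrix.det_mul, Matrix.det_mul, Matrix.det_conjTranspose, norm_mul, norm_mul, norm_star]
  calc ‖J.det‖ * ‖(1 - κᴴ * κ).det‖ * ‖J.det‖
      ≤ (m.factorial * 2 ^ m * ‖α.det‖⁻¹) * (m.factorial * 2 ^ m) *
        (m.factorial * 2 ^ m * ‖α.det‖⁻¹) := by gcongr
    _ = _ := by ring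

end DiskGeometry

section Packing

open scoped ComplexOrder MatrixOrder Matrix.Norms.L2Operator

lemma IsSymplectic.mul {m : ℕ} {g h : Matrix (Fin m ⊕ Fin m) (Fin m ⊕ Fin m) ℝ}
    (hg : IsSymplectic g) (hh : IsSymplectic h) : IsSymplectic (g * h) := by
  have : (g * h)ᵀ * Wmat m * (g * h) = hᵀ * (gᵀ * Wmat m * g) * h := by
    rw [Matrix.transpose_mul]
    noncomm_ring
  rw [IsSymplectic, this, hg, hh]

lemma abs_apply_le_four_of_mem_discNbhd {m : ℕ}
    {u h : Matrix (Fin m ⊕ Fin m) (Fin m ⊕ Fin m) ℝ} (hu : IsSymplectic u) (hh : IsSymplectic h)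
    {ζ : symMat m} (h₁ : ζ ∈ discNbhd (cayA h) (cayB h))
    (h₂ : ζ ∈ discNbhd (cayA (u * h)) (cayB (u * h))) (i j : Fin m ⊕ Fin m) : |u i j| ≤ 4 := by
  obtain ⟨κ, hκ, he, hJ, -⟩ := hh.isPseudoUnitary.exists_of_mem_discNbhd h₁
  obtain ⟨κ', hκ', he', -, -⟩ := (hu.mul hh).isPseudoUnitary.exists_of_mem_discNbhd h₂
  set J := (cayB h)ᴴᵀ * ζ.1 + (cayA h)ᴴᵀ with hJd
  have hI' : cayA (u * h) * ζ.1 + cayB (u * h) = (cayA u * κ + cayB u) * J := by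
    rw [cayA_mul, cayB_mul, Matrix.add_mul (cayA u * κ), Matrix.mul_assoc, ← he, hJd]
    noncomm_ring
  have hJ' : (cayB (u * h))ᴴᵀ * ζ.1 + (cayA (u * h))ᴴᵀ =
      ((cayB u)ᴴᵀ * κ + (cayA u)ᴴᵀ) * J := by
    rw [cayA_mul, cayB_mul, Matrix.add_mul ((cayB u)ᴴᵀ * κ), Matrix.mul_assoc, ← he, hJd]
    simp only [Matrix.conjTranspose_add, Matrix.conjTranspose_mul, Matrix.transpose_add,
      Matrix.transpose_mul]
    have hcc : ∀ A : Matrix (Fin m) (Fin m) ℂ, Aᴴᵀᴴᵀ = A := fun A => by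
      ext i j
      simp
    rw [hcc, hcc]
    noncomm_ring
  rw [hI', hJ', ← Matrix.mul_assoc] at he'
  have hc := congrArg (· * J⁻¹) he'
  simp only [Matrix.mul_assoc, Matrix.mul_nonsing_inv _ hJ, Matrix.mul_one] at hc
  obtain ⟨hA, hB⟩ := hu.isPseudoUnitary.norm_le_two hκ hκ' hc
  have hA' : ∀ i j, ‖cayA u i j‖ ≤ 2 := fun i j => by
    have := (norm_apply_le_l2 (cayA u)ᴴᵀ i j).trans hA
    simpa using this
  have hB' : ∀ i j, ‖cayB u i j‖ ≤ 2 := fun i j => by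
    have := (norm_apply_le_l2 (cayB u)ᴴᵀ i j).trans hB
    simpa using this
  have hadd : ∀ i j, ‖cayA u i j + cayB u i j‖ ≤ 4 := fun i j =>
    (norm_add_le _ _).trans (by linarith [hA' i j, hB' i j])
  have hsub : ∀ i j, ‖cayA u i j - cayB u i j‖ ≤ 4 := fun i j =>
    (norm_sub_le _ _).trans (by linarith [hA' i j, hB' i j])
  have e1 : ∀ i j, cayA u i j + cayB u i j =
      (u (Sum.inl i) (Sum.inl j) : ℂ) - (u (Sum.inr i) (Sum.inl j) : ℂ) * Complex.I := by
    intro i j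
    simp [cayA, cayB, cmat, Matrix.toBlocks₁₁, Matrix.toBlocks₁₂, Matrix.toBlocks₂₁,
      Matrix.toBlocks₂₂]
    ring
  have e2 : ∀ i j, cayA u i j - cayB u i j =
      (u (Sum.inr i) (Sum.inr j) : ℂ) + (u (Sum.inl i) (Sum.inr j) : ℂ) * Complex.I := by
    intro i j
    simp [cayA, cayB, cmat, Matrix.toBlocks₁₁, Matrix.toBlocks₁₂, Matrix.toBlocks₂₁,
      Matrix.toBlocks₂₂]
    ring
  rcases i with i | i <;> rcases j with j | j
  · have := (Complex.abs_re_le_norm _).trans (hadd i j)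
    rw [e1] at this
    simpa using this
  · have := (Complex.abs_im_le_norm _).trans (hsub i j)
    rw [e2] at this
    simpa using this
  · have := (Complex.abs_im_le_norm _).trans (hadd i j)
    rw [e1] at this
    simpa using this
  · have := (Complex.abs_re_le_norm _).trans (hsub i j)
    rw [e2] at this
    simpa using this

lemma finite_integral_abs_le (m : ℕ) (B : ℝ) :
    {u : Matrix (Fin m ⊕ Fin m) (Fin m ⊕ Fin m) ℝ |
      IsIntegralMat u ∧ ∀ i j, |u i j| ≤ B}.Finite := by
  have h1 : ((fun n : ℤ => (n : ℝ)) '' Set.Icc (-⌊B⌋) ⌊B⌋).Finite := (Set.finite_Icc _ _).image _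
  have h2 : (Set.univ.pi fun _ : Fin m ⊕ Fin m => Set.univ.pi fun _ : Fin m ⊕ Fin m =>
      (fun n : ℤ => (n : ℝ)) '' Set.Icc (-⌊B⌋) ⌊B⌋).Finite :=
    Set.Finite.pi fun _ => Set.Finite.pi fun _ => h1
  refine h2.subset ?_
  rintro u ⟨hu, hB⟩ i - j -
  obtain ⟨n, hn⟩ := hu i j
  have h3 := abs_le.1 (hB i j)
  rw [hn] at h3
  refine ⟨n, ⟨?_, Int.le_floor.2 h3.2⟩, hn.symm⟩
  have : -n ≤ ⌊B⌋ := Int.le_floor.2 (by push_cast; linarith)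
  linarith

lemma IsIntegralMat.mul {m : ℕ} {g h : Matrix (Fin m ⊕ Fin m) (Fin m ⊕ Fin m) ℝ}
    (hg : IsIntegralMat g) (hh : IsIntegralMat h) : IsIntegralMat (g * h) := by
  intro i j
  choose a ha using hg
  choose b hb using hh
  exact ⟨∑ k, a i k * b k j, by simp [Matrix.mul_apply, ha, hb]⟩

lemma Wmat_mul_self (m : ℕ) : Wmat m * Wmat m = -1 := by
  rw [Wmat, Matrix.fromBlocks_multiply, ← Matrix.fromBlocks_one, Matrix.fromBlocks_neg]
  simp

lemma Wmat_integral (m : ℕ) : IsIntegralMat (Wmat m) := by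
  intro i j
  rcases i with i | i <;> rcases j with j | j
  · exact ⟨0, by simp [Wmat]⟩
  · exact ⟨(-1 : Matrix (Fin m) (Fin m) ℤ) i j, by by_cases h : i = j <;> simp [Wmat, h]⟩
  · exact ⟨(1 : Matrix (Fin m) (Fin m) ℤ) i j, by
      by_cases h : i = j <;> simp [Wmat, Matrix.one_apply, h]⟩
  · exact ⟨0, by simp [Wmat]⟩

/-- Integral symplectic matrices have integral symplectic inverses. -/
lemma IsSymplectic.exists_inv {m : ℕ} {g : Matrix (Fin m ⊕ Fin m) (Fin m ⊕ Fin m) ℝ}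
    (hg : IsSymplectic g) (hi : IsIntegralMat g) :
    ∃ g', IsSymplectic g' ∧ IsIntegralMat g' ∧ g' * g = 1 ∧ g * g' = 1 := by
  have h1 : (-(Wmat m * gᵀ * Wmat m)) * g = 1 := by
    have : (-(Wmat m * gᵀ * Wmat m)) * g = -(Wmat m * (gᵀ * Wmat m * g)) := by noncomm_ring
    rw [this, hg, Wmat_mul_self, neg_neg]
  have h2 := mul_eq_one_comm.1 h1
  refine ⟨_, ?_, ?_, h1, h2⟩
  · set g' := -(Wmat m * gᵀ * Wmat m)
    have h3 : g'ᵀ * gᵀ = 1 := by rw [← Matrix.transpose_mul, h2, Matrix.transpose_one]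
    calc g'ᵀ * Wmat m * g' = g'ᵀ * (gᵀ * Wmat m * g) * g' := by rw [hg]
      _ = (g'ᵀ * gᵀ) * Wmat m * (g * g') := by noncomm_ring
      _ = Wmat m := by rw [h3, h2, Matrix.one_mul, Matrix.mul_one]
  · intro i j
    have ht : IsIntegralMat gᵀ := fun i j => hi j i
    obtain ⟨n, hn⟩ := (((Wmat_integral m).mul ht).mul (Wmat_integral m)) i j
    exact ⟨-n, by rw [Matrix.neg_apply, hn]; push_cast; rfl⟩

/-- The neighbourhoods attached to integral symplectic matrices have bounded overlap. -/
lemma exists_card_discNbhd_le (m : ℕ) : ∃ N : ℕ,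
    ∀ A : Finset (Matrix (Fin m ⊕ Fin m) (Fin m ⊕ Fin m) ℝ),
      (∀ g ∈ A, IsSymplectic g ∧ IsIntegralMat g) →
      ∀ p : Matrix (Fin m ⊕ Fin m) (Fin m ⊕ Fin m) ℝ, IsSymplectic p → ∀ ζ : symMat m,
        (∀ g ∈ A, ζ ∈ discNbhd (cayA (g * p)) (cayB (g * p))) → A.card ≤ N := by
  classical
  refine ⟨(finite_integral_abs_le m 4).toFinset.card, fun A hA p hp ζ hζ => ?_⟩
  rcases A.eq_empty_or_nonempty with rfl | ⟨g₀, hg₀⟩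
  · simp
  obtain ⟨g', hg's, hg'i, hl, hr⟩ := (hA g₀ hg₀).1.exists_inv (hA g₀ hg₀).2
  refine Finset.card_le_card_of_injOn (· * g') ?_ ?_
  · intro g hg
    rw [Finset.mem_coe] at hg
    simp only [Set.Finite.coe_toFinset]
    refine ⟨(hA g hg).2.mul hg'i, ?_⟩
    refine abs_apply_le_four_of_mem_discNbhd ((hA g hg).1.mul hg's) ((hA g₀ hg₀).1.mul hp)
      (hζ g₀ hg₀) ?_
    have : g * g' * (g₀ * p) = g * p := by
      rw [Matrix.mul_assoc, ← Matrix.mul_assoc g', hl, Matrix.one_mul]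
    rw [this]
    exact hζ g hg
  · intro a _ b _ hab
    have := congrArg (· * g₀) hab
    simpa only [Matrix.mul_assoc, hl, Matrix.mul_one] using this

end Packing

section Volume

open scoped ComplexOrder MatrixOrder Matrix.Norms.L2Operator

/-- The symmetric matrices of operator norm less than `1/4`. -/
def smallDisk (m : ℕ) : Set (symMat m) := {η | ‖η.1‖ < 1 / 4}

lemma zero_mem_smallDisk (m : ℕ) : (0 : symMat m) ∈ smallDisk m := by
  change ‖(0 : Matrix (Fin m) (Fin m) ℂ)‖ < 1 / 4
  rw [norm_zero]
  norm_num

lemma isOpen_smallDisk (m : ℕ) : IsOpen (smallDisk m) :=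
  isOpen_lt (continuous_subtype_val.norm) continuous_const

lemma IsPseudoUnitary.discNbhd_eq {m : ℕ} {α β : Matrix (Fin m) (Fin m) ℂ}
    (h : IsPseudoUnitary α β) : ∃ S₀ : symMat m, discNbhd α β =
      (fun ζ => S₀ + ζ) '' ((symCongr α⁻¹).restrictScalars ℝ '' smallDisk m) := by
  have hα := h.isUnit_det
  have hs : (-(α⁻¹ * β))ᵀ = -(α⁻¹ * β) := by
    have h1 : βᵀ * (α⁻¹)ᵀ = α⁻¹ * β := by
      calc βᵀ * (α⁻¹)ᵀ = α⁻¹ * (α * βᵀ) * (α⁻¹)ᵀ := by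
            rw [← Matrix.mul_assoc, Matrix.nonsing_inv_mul _ hα, Matrix.one_mul]
        _ = α⁻¹ * β * (αᵀ * (α⁻¹)ᵀ) := by
            rw [h.right_off]
            simp only [Matrix.mul_assoc]
        _ = α⁻¹ * β := by
            rw [← Matrix.transpose_mul, Matrix.nonsing_inv_mul _ hα, Matrix.transpose_one,
              Matrix.mul_one]
    rw [Matrix.transpose_neg, Matrix.transpose_mul, h1]
  refine ⟨⟨-(α⁻¹ * β), hs⟩, ?_⟩
  have key : ∀ η : symMat m, α⁻¹ * (η.1 * (α⁻¹)ᵀ - β) = -(α⁻¹ * β) + α⁻¹ * η.1 * (α⁻¹)ᵀ :=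
    fun η => by noncomm_ring
  ext ζ
  constructor
  · rintro ⟨η, hη, hζ⟩
    refine ⟨_, ⟨η, hη, rfl⟩, Subtype.ext ?_⟩
    rw [hζ, key]
    rfl
  · rintro ⟨_, ⟨η, hη, rfl⟩, rfl⟩
    refine ⟨η, hη, ?_⟩
    rw [key]
    rfl

lemma IsPseudoUnitary.measurableSet_discNbhd {m : ℕ} {α β : Matrix (Fin m) (Fin m) ℂ}
    (h : IsPseudoUnitary α β) : MeasurableSet (discNbhd α β) := by
  obtain ⟨S₀, hS⟩ := h.discNbhd_eq
  have hsurj : Function.Surjective (symCongr α⁻¹) := fun S => ⟨symCongr α S, by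
    rw [← Module.End.mul_apply, ← symCongr_mul, Matrix.nonsing_inv_mul _ h.isUnit_det,
      symCongr_one, Module.End.one_apply]⟩
  have hopen : IsOpenMap (symCongr α⁻¹) :=
    LinearMap.isOpenMap_of_finiteDimensional _ hsurj
  rw [hS]
  exact ((isOpenMap_add_left S₀) _ (hopen _ (isOpen_smallDisk m))).measurableSet

lemma IsPseudoUnitary.measure_discNbhd {m : ℕ} {α β : Matrix (Fin m) (Fin m) ℂ}
    (h : IsPseudoUnitary α β) (μ : Measure (symMat m)) [μ.IsAddHaarMeasure] :
    μ (discNbhd α β) = ENNReal.ofReal (‖α.det‖⁻¹ ^ (2 * (m + 1))) * μ (smallDisk m) := by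
  obtain ⟨S₀, hS⟩ := h.discNbhd_eq
  rw [hS, Set.image_add_left, measure_preimage_add, Measure.addHaar_image_linearMap,
    abs_det_symCongr_restrictScalars _ ((Matrix.isUnit_nonsing_inv_det_iff).2 h.isUnit_det).ne_zero,
    Matrix.det_nonsing_inv, Ring.inverse_eq_inv', norm_inv]

end Volume

/-- The sum of `|det α(gp)|^{-2σ}` over finite sets of integral symplectic `g` is bounded. -/
lemma exists_sum_cayA_le (m : ℕ) {σ : ℝ} (h₁ : (m : ℝ) < σ) (h₂ : σ < m + 1) : ∃ C : ℝ,
    ∀ A : Finset (Matrix (Fin m ⊕ Fin m) (Fin m ⊕ Fin m) ℝ),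
      (∀ g ∈ A, IsSymplectic g ∧ IsIntegralMat g) →
      ∀ p : Matrix (Fin m ⊕ Fin m) (Fin m ⊕ Fin m) ℝ, IsSymplectic p →
        ∑ g ∈ A, ‖(cayA (g * p)).det‖⁻¹ ^ (2 * σ) ≤ C := by
  classical
  obtain ⟨N, hN⟩ := exists_card_discNbhd_le m
  set a := m + 1 - σ with ha
  have ha0 : 0 < a := by linarith
  obtain ⟨μ, hμ, -, hfin⟩ := exists_haar_lintegral_diskWeight_lt_top m (a := a) (by linarith)
  set D : ℝ := (m.factorial * 2 ^ m) ^ 3 with hD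
  have hD0 : 0 < D := by positivity
  have hB : μ (smallDisk m) ≠ 0 :=
    ((isOpen_smallDisk m).measure_pos μ ⟨0, zero_mem_smallDisk m⟩).ne'
  set K : ENNReal := N * (∫⁻ Z, diskWeight a Z ∂μ) / μ (smallDisk m) with hK
  have hKt : K ≠ ⊤ :=
    (ENNReal.div_lt_top (ENNReal.mul_ne_top (ENNReal.natCast_ne_top N) hfin.ne) hB).ne
  refine ⟨D ^ a * K.toReal, fun A hA p hp => ?_⟩
  set t : Matrix (Fin m ⊕ Fin m) (Fin m ⊕ Fin m) ℝ → ℝ := fun g => ‖(cayA (g * p)).det‖⁻¹ with ht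
  set S : Matrix (Fin m ⊕ Fin m) (Fin m ⊕ Fin m) ℝ → Set (symMat m) :=
    fun g => discNbhd (cayA (g * p)) (cayB (g * p)) with hS
  have hpu : ∀ g ∈ A, IsPseudoUnitary (cayA (g * p)) (cayB (g * p)) :=
    fun g hg => ((hA g hg).1.mul hp).isPseudoUnitary
  have htpos : ∀ g ∈ A, 0 < t g := fun g hg =>
    inv_pos.2 (norm_pos_iff.2 (hpu g hg).isUnit_det.ne_zero)
  have hterm : ∀ g ∈ A, ENNReal.ofReal (D ^ (-a) * t g ^ (2 * σ)) * μ (smallDisk m) =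
      ENNReal.ofReal ((D * t g ^ 2) ^ (-a)) * μ (S g) := by
    intro g hg
    have h0 := htpos g hg
    rw [(hpu g hg).measure_discNbhd, ← mul_assoc, ← ENNReal.ofReal_mul (by positivity)]
    congr 2
    rw [Real.mul_rpow hD0.le (by positivity), mul_assoc]
    congr 1
    change _ = (t g ^ 2) ^ (-a) * t g ^ (2 * (m + 1))
    rw [← Real.rpow_natCast (t g) 2, ← Real.rpow_natCast (t g) (2 * (m + 1)),
      ← Real.rpow_mul h0.le, ← Real.rpow_add h0]
    congr 1
    push_cast
    ring
  have hpt : ∀ ζ : symMat m, ∑ g ∈ A, (S g).indicator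
      (fun _ => ENNReal.ofReal ((D * t g ^ 2) ^ (-a))) ζ ≤ N * diskWeight a ζ := by
    intro ζ
    have h1 : ∀ g ∈ A, (S g).indicator (fun _ => ENNReal.ofReal ((D * t g ^ 2) ^ (-a))) ζ ≤
        if ζ ∈ S g then diskWeight a ζ else 0 := by
      intro g hg
      rw [Set.indicator_apply]
      split_ifs with hζ
      · obtain ⟨hpd, hle⟩ := (hpu g hg).det_le_of_mem_discNbhd hζ
        rw [diskWeight, if_pos hpd]
        refine ENNReal.ofReal_le_ofReal ?_
        exact Real.rpow_le_rpow_of_nonpos (Complex.pos_iff.1 hpd.det_pos).1 hle (by linarith)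
      · exact le_rfl
    refine (Finset.sum_le_sum h1).trans ?_
    rw [← Finset.sum_filter, Finset.sum_const, nsmul_eq_mul]
    gcongr
    refine hN _ (fun g hg => hA g (Finset.mem_filter.1 hg).1) p hp ζ
      fun g hg => (Finset.mem_filter.1 hg).2
  have hsum : (∑ g ∈ A, ENNReal.ofReal (D ^ (-a) * t g ^ (2 * σ))) * μ (smallDisk m) ≤
      N * ∫⁻ Z, diskWeight a Z ∂μ := by
    calc (∑ g ∈ A, ENNReal.ofReal (D ^ (-a) * t g ^ (2 * σ))) * μ (smallDisk m)
        = ∑ g ∈ A, ∫⁻ ζ, (S g).indicator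
            (fun _ => ENNReal.ofReal ((D * t g ^ 2) ^ (-a))) ζ ∂μ := by
          rw [Finset.sum_mul]
          refine Finset.sum_congr rfl fun g hg => ?_
          rw [hterm g hg, lintegral_indicator_const (hpu g hg).measurableSet_discNbhd]
      _ = ∫⁻ ζ, ∑ g ∈ A, (S g).indicator
            (fun _ => ENNReal.ofReal ((D * t g ^ 2) ^ (-a))) ζ ∂μ :=
          (lintegral_finsetSum _ fun g hg =>
            measurable_const.indicator (hpu g hg).measurableSet_discNbhd).symm
      _ ≤ ∫⁻ ζ, N * diskWeight a ζ ∂μ := lintegral_mono hpt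
      _ = _ := lintegral_const_mul' _ _ (ENNReal.natCast_ne_top N)
  have hle : ENNReal.ofReal (∑ g ∈ A, D ^ (-a) * t g ^ (2 * σ)) ≤ K := by
    rw [ENNReal.ofReal_sum_of_nonneg fun g hg =>
      mul_nonneg (by positivity) (Real.rpow_nonneg (htpos g hg).le _)]
    rw [hK]
    exact (ENNReal.le_div_iff_mul_le (Or.inl hB) (Or.inr
      (ENNReal.mul_ne_top (ENNReal.natCast_ne_top N) hfin.ne))).2 hsum
  have hreal := (ENNReal.ofReal_le_iff_le_toReal hKt).1 hle
  rw [← Finset.mul_sum] at hreal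
  calc ∑ g ∈ A, t g ^ (2 * σ) = D ^ a * (D ^ (-a) * ∑ g ∈ A, t g ^ (2 * σ)) := by
        rw [← mul_assoc, ← Real.rpow_add hD0, add_neg_cancel, Real.rpow_zero, one_mul]
    _ ≤ D ^ a * K.toReal := by gcongr

section SiegelAction

open scoped ComplexOrder

lemma cmat_mul {m : ℕ} (A B : Matrix (Fin m) (Fin m) ℝ) : cmat (A * B) = cmat A * cmat B :=
  map_ofReal_mul A B

lemma cmat_add {m : ℕ} (A B : Matrix (Fin m) (Fin m) ℝ) : cmat (A + B) = cmat A + cmat B := by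
  ext i j
  simp [cmat]

lemma cmat_one {m : ℕ} : cmat (1 : Matrix (Fin m) (Fin m) ℝ) = 1 := by
  ext i j
  by_cases h : i = j <;> simp [cmat, Matrix.one_apply, h]

lemma cmat_transpose {m : ℕ} (A : Matrix (Fin m) (Fin m) ℝ) : cmat Aᵀ = (cmat A)ᵀ := rfl

lemma cmat_det {m : ℕ} (A : Matrix (Fin m) (Fin m) ℝ) : (cmat A).det = A.det :=
  (Complex.ofRealHom.map_det A).symm

/-- The numerator `ai + b` of the action of `[[a, b], [c, d]]` on the point `i`. -/
def numAt {m : ℕ} (h : Matrix (Fin m ⊕ Fin m) (Fin m ⊕ Fin m) ℝ) : Matrix (Fin m) (Fin m) ℂ :=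
  cmat h.toBlocks₁₁ * Complex.I • 1 + cmat h.toBlocks₁₂

/-- The denominator `ci + d` of the action of `[[a, b], [c, d]]` on the point `i`. -/
def denAt {m : ℕ} (h : Matrix (Fin m ⊕ Fin m) (Fin m ⊕ Fin m) ℝ) : Matrix (Fin m) (Fin m) ℂ :=
  cmat h.toBlocks₂₁ * Complex.I • 1 + cmat h.toBlocks₂₂

lemma denAt_eq {m : ℕ} (h : Matrix (Fin m ⊕ Fin m) (Fin m ⊕ Fin m) ℝ) :
    denAt h = (cayA h)ᴴᵀ - cayB h := by
  ext i j
  simp [denAt, cayA, cayB, cmat]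
  ring

lemma numAt_eq {m : ℕ} (h : Matrix (Fin m ⊕ Fin m) (Fin m ⊕ Fin m) ℝ) :
    numAt h = Complex.I • ((cayA h)ᴴᵀ + cayB h) := by
  ext i j
  simp [numAt, cayA, cayB, cmat]
  ring_nf
  simp only [Complex.I_sq]
  ring

lemma IsSymplectic.denAt_mul_numAt {m : ℕ} {h : Matrix (Fin m ⊕ Fin m) (Fin m ⊕ Fin m) ℝ}
    (hh : IsSymplectic h) :
    (denAt h)ᴴ * numAt h - (numAt h)ᴴ * denAt h = (2 * Complex.I) • 1 := by
  have hp := hh.isPseudoUnitary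
  have hc : ∀ A : Matrix (Fin m) (Fin m) ℂ, Aᴴᵀᴴ = Aᵀ := fun A => by
    ext i j
    simp
  have e := congrArg (fun A : Matrix (Fin m) (Fin m) ℂ => Aᵀ) hp.left_diag
  simp only [Matrix.transpose_sub, Matrix.transpose_mul, Matrix.transpose_transpose,
    Matrix.transpose_one] at e
  rw [denAt_eq, numAt_eq, ← e]
  simp only [Matrix.conjTranspose_sub, Matrix.conjTranspose_smul, Matrix.conjTranspose_add, hc,
    Complex.star_def, Complex.conj_I, Matrix.mul_smul, Matrix.smul_mul, Matrix.sub_mul,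
    Matrix.mul_sub, Matrix.add_mul, Matrix.mul_add]
  module

lemma IsSymplectic.transpose_numAt_mul {m : ℕ} {h : Matrix (Fin m ⊕ Fin m) (Fin m ⊕ Fin m) ℝ}
    (hh : IsSymplectic h) : (numAt h)ᵀ * denAt h = (denAt h)ᵀ * numAt h := by
  have hp := hh.isPseudoUnitary
  rw [denAt_eq, numAt_eq]
  simp only [Matrix.transpose_sub, Matrix.transpose_smul, Matrix.transpose_add,
    Matrix.transpose_transpose, Matrix.mul_smul, Matrix.smul_mul, Matrix.sub_mul, Matrix.mul_sub,
    Matrix.add_mul, Matrix.mul_add]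
  rw [hp.left_off]
  module

lemma IsSymplectic.isUnit_det_denAt {m : ℕ} {h : Matrix (Fin m ⊕ Fin m) (Fin m ⊕ Fin m) ℝ}
    (hh : IsSymplectic h) : IsUnit (denAt h).det := by
  rw [isUnit_iff_ne_zero]
  intro h0
  obtain ⟨v, hv0, hv⟩ := Matrix.exists_mulVec_eq_zero_iff.2 h0
  have h1 := congrArg (fun A : Matrix (Fin m) (Fin m) ℂ => star v ⬝ᵥ A *ᵥ v) hh.denAt_mul_numAt
  simp only [Matrix.sub_mulVec, ← Matrix.mulVec_mulVec, hv, Matrix.mulVec_zero, sub_zero,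
    Matrix.smul_mulVec, Matrix.one_mulVec, dotProduct_smul] at h1
  rw [Matrix.dotProduct_mulVec, ← Matrix.star_mulVec, hv, star_zero, zero_dotProduct] at h1
  have h2 := (smul_eq_zero.1 h1.symm).resolve_left (by simp)
  exact hv0 (dotProduct_star_self_eq_zero.1 h2)

lemma act_I {m : ℕ} (h : Matrix (Fin m ⊕ Fin m) (Fin m ⊕ Fin m) ℝ) :
    act h (Complex.I • 1) = numAt h * (denAt h)⁻¹ := rfl

lemma IsSymplectic.act_I_transpose {m : ℕ} {h : Matrix (Fin m ⊕ Fin m) (Fin m ⊕ Fin m) ℝ}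
    (hh : IsSymplectic h) : (act h (Complex.I • 1))ᵀ = act h (Complex.I • 1) := by
  have hu := hh.isUnit_det_denAt
  have hut : IsUnit (denAt h)ᵀ.det := by rwa [Matrix.det_transpose]
  rw [act_I, Matrix.transpose_mul, Matrix.transpose_nonsing_inv]
  calc (denAt h)ᵀ⁻¹ * (numAt h)ᵀ = (denAt h)ᵀ⁻¹ * ((numAt h)ᵀ * denAt h) * (denAt h)⁻¹ := by
        rw [Matrix.mul_assoc, Matrix.mul_assoc, Matrix.mul_nonsing_inv _ hu, Matrix.mul_one]
    _ = numAt h * (denAt h)⁻¹ := by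
        rw [hh.transpose_numAt_mul, ← Matrix.mul_assoc, Matrix.nonsing_inv_mul _ hut,
          Matrix.one_mul]

lemma cmat_imPart {m : ℕ} {Z : Matrix (Fin m) (Fin m) ℂ} (hZ : Zᵀ = Z) :
    (2 * Complex.I) • cmat (imPart Z) = Z - Zᴴ := by
  ext i j
  have h1 : Z j i = Z i j := congrFun (congrFun hZ i) j
  simp only [cmat, imPart, Matrix.smul_apply, Matrix.map_apply, Matrix.of_apply, smul_eq_mul,
    Matrix.sub_apply, Matrix.conjTranspose_apply, h1, Complex.star_def, Complex.sub_conj]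
  push_cast
  ring

lemma IsSymplectic.cmat_imPart_act_I {m : ℕ} {h : Matrix (Fin m ⊕ Fin m) (Fin m ⊕ Fin m) ℝ}
    (hh : IsSymplectic h) : cmat (imPart (act h (Complex.I • 1))) =
      ((denAt h)⁻¹)ᴴ * (denAt h)⁻¹ := by
  have hu := hh.isUnit_det_denAt
  have hI : (2 * Complex.I) ≠ 0 := by simp
  refine smul_right_injective _ hI ?_
  change (2 * Complex.I) • _ = (2 * Complex.I) • _
  have huc : ((denAt h)⁻¹)ᴴ * (denAt h)ᴴ = 1 := by
    rw [← Matrix.conjTranspose_mul, Matrix.mul_nonsing_inv _ hu, Matrix.conjTranspose_one]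
  rw [cmat_imPart hh.act_I_transpose, act_I]
  calc numAt h * (denAt h)⁻¹ - (numAt h * (denAt h)⁻¹)ᴴ
      = (((denAt h)⁻¹)ᴴ * (denAt h)ᴴ) * numAt h * (denAt h)⁻¹ -
        ((denAt h)⁻¹)ᴴ * (numAt h)ᴴ * (denAt h * (denAt h)⁻¹) := by
        rw [huc, Matrix.one_mul, Matrix.mul_nonsing_inv _ hu, Matrix.mul_one,
          Matrix.conjTranspose_mul]
    _ = ((denAt h)⁻¹)ᴴ * ((denAt h)ᴴ * numAt h - (numAt h)ᴴ * denAt h) * (denAt h)⁻¹ := by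
        noncomm_ring
    _ = _ := by rw [hh.denAt_mul_numAt, Matrix.mul_smul, Matrix.smul_mul, Matrix.mul_one]

lemma IsSymplectic.posDef_imPart_act_I {m : ℕ} {h : Matrix (Fin m ⊕ Fin m) (Fin m ⊕ Fin m) ℝ}
    (hh : IsSymplectic h) : (imPart (act h (Complex.I • 1))).PosDef := by
  have hu := (Matrix.isUnit_nonsing_inv_det_iff).2 hh.isUnit_det_denAt
  have hpd : (cmat (imPart (act h (Complex.I • 1)))).PosDef := by
    rw [hh.cmat_imPart_act_I]
    exact Matrix.PosDef.conjTranspose_mul_self _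
      (Matrix.mulVec_injective_of_isUnit ((Matrix.isUnit_iff_isUnit_det _).2 hu))
  set Y := imPart (act h (Complex.I • 1)) with hY
  refine Matrix.PosDef.of_dotProduct_mulVec_pos ?_ fun x hx => ?_
  · ext i j
    have h1 := congrFun (congrFun hh.act_I_transpose i) j
    simp only [hY, imPart, Matrix.conjTranspose_apply, Matrix.of_apply, star_trivial]
    rw [← h1, Matrix.transpose_apply]
  · have hx' : (fun i => (x i : ℂ)) ≠ 0 := fun h0 => hx <| funext fun i => by
      simpa using congrFun h0 i
    have h2 := (Complex.pos_iff.1 (hpd.dotProduct_mulVec_pos hx')).1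
    have h3 : star (fun i => (x i : ℂ)) ⬝ᵥ cmat Y *ᵥ (fun i => (x i : ℂ)) =
        ((star x ⬝ᵥ Y *ᵥ x : ℝ) : ℂ) := by
      simp [dotProduct, mulVec, cmat]
    rwa [h3, Complex.ofReal_re] at h2

lemma IsSymplectic.det_imPart_act_I {m : ℕ} {h : Matrix (Fin m ⊕ Fin m) (Fin m ⊕ Fin m) ℝ}
    (hh : IsSymplectic h) : (imPart (act h (Complex.I • 1))).det * (2 ^ m * ‖(cayA h).det‖) ^ 2 =
      ‖(act h (Complex.I • 1) + Complex.I • 1).det‖ ^ 2 := by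
  have hu := hh.isUnit_det_denAt
  have h1 : ((imPart (act h (Complex.I • 1))).det : ℂ) =
      star (denAt h).det⁻¹ * (denAt h).det⁻¹ := by
    rw [← cmat_det, hh.cmat_imPart_act_I, Matrix.det_mul, Matrix.det_conjTranspose,
      Matrix.det_nonsing_inv, Ring.inverse_eq_inv']
  have h2 : (imPart (act h (Complex.I • 1))).det = ‖(denAt h).det‖⁻¹ ^ 2 := by
    rw [← norm_inv]
    apply Complex.ofReal_injective
    rw [h1, Complex.star_def, Complex.conj_mul']
    push_cast
    rfl
  have h3 : (act h (Complex.I • 1) + Complex.I • 1) * denAt h =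
      (2 * Complex.I) • (cayA h)ᴴᵀ := by
    rw [act_I, Matrix.add_mul, Matrix.mul_assoc, Matrix.nonsing_inv_mul _ hu, Matrix.mul_one,
      Matrix.smul_mul, Matrix.one_mul, numAt_eq, denAt_eq, ← smul_add, mul_comm, mul_smul, two_smul]
    congr 1
    abel
  have h4 := congrArg (fun A : Matrix (Fin m) (Fin m) ℂ => ‖A.det‖) h3
  simp only [Matrix.det_mul, Matrix.det_smul, norm_mul, Matrix.det_transpose,
    Matrix.det_conjTranspose, norm_star, norm_pow, Fintype.card_fin, Complex.norm_I, mul_one,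
    Complex.norm_two] at h4
  have h5 : ‖(denAt h).det‖ ≠ 0 := norm_ne_zero_iff.2 hu.ne_zero
  rw [h2, ← h4]
  field_simp

end SiegelAction

section Parabolic

/-- The matrix `[[a, s d], [0, d]]`, symplectic when `s` is symmetric and `a dᵀ = 1`. -/
def parabMat {m : ℕ} (a d s : Matrix (Fin m) (Fin m) ℝ) :
    Matrix (Fin m ⊕ Fin m) (Fin m ⊕ Fin m) ℝ :=
  Matrix.fromBlocks a (s * d) 0 d

lemma isSymplectic_parabMat {m : ℕ} {a d s : Matrix (Fin m) (Fin m) ℝ} (had : a * dᵀ = 1)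
    (hs : sᵀ = s) : IsSymplectic (parabMat a d s) := by
  have h1 : dᵀ * a = 1 := mul_eq_one_comm.1 had
  have h2 : aᵀ * d = 1 := by simpa using congrArg Matrix.transpose h1
  unfold IsSymplectic Wmat parabMat
  rw [Matrix.fromBlocks_transpose, Matrix.fromBlocks_multiply, Matrix.fromBlocks_multiply]
  simp [h1, h2, hs, Matrix.mul_assoc]

lemma isIntegralMat_parabMat {m : ℕ} {a d s : Matrix (Fin m) (Fin m) ℝ}
    (ha : ∀ i j, ∃ n : ℤ, a i j = n) (hd : ∀ i j, ∃ n : ℤ, d i j = n)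
    (hs : ∀ i j, ∃ n : ℤ, s i j = n) : IsIntegralMat (parabMat a d s) := by
  choose d' hd using hd
  choose s' hs using hs
  rintro (i | i) (j | j)
  · exact ha i j
  · exact ⟨∑ k, s' i k * d' k j, by simp [parabMat, Matrix.mul_apply, hd, hs]⟩
  · exact ⟨0, by simp [parabMat]⟩
  · exact ⟨d' i j, hd i j⟩

lemma numAt_mul {m : ℕ} (g h : Matrix (Fin m ⊕ Fin m) (Fin m ⊕ Fin m) ℝ) :
    numAt (g * h) = cmat g.toBlocks₁₁ * numAt h + cmat g.toBlocks₁₂ * denAt h := by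
  conv_lhs => rw [← Matrix.fromBlocks_toBlocks g, ← Matrix.fromBlocks_toBlocks h,
    Matrix.fromBlocks_multiply]
  simp only [numAt, denAt, Matrix.toBlocks_fromBlocks₁₁, Matrix.toBlocks_fromBlocks₁₂, cmat_add,
    cmat_mul, Matrix.mul_smul, Matrix.mul_one, Matrix.mul_add]
  module

lemma denAt_mul {m : ℕ} (g h : Matrix (Fin m ⊕ Fin m) (Fin m ⊕ Fin m) ℝ) :
    denAt (g * h) = cmat g.toBlocks₂₁ * numAt h + cmat g.toBlocks₂₂ * denAt h := by
  conv_lhs => rw [← Matrix.fromBlocks_toBlocks g, ← Matrix.fromBlocks_toBlocks h,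
    Matrix.fromBlocks_multiply]
  simp only [numAt, denAt, Matrix.toBlocks_fromBlocks₂₁, Matrix.toBlocks_fromBlocks₂₂, cmat_add,
    cmat_mul, Matrix.mul_smul, Matrix.mul_one, Matrix.mul_add]
  module

lemma act_mul_I {m : ℕ} (g : Matrix (Fin m ⊕ Fin m) (Fin m ⊕ Fin m) ℝ)
    {h : Matrix (Fin m ⊕ Fin m) (Fin m ⊕ Fin m) ℝ} (hh : IsSymplectic h) :
    act (g * h) (Complex.I • 1) = act g (act h (Complex.I • 1)) := by
  have hu := hh.isUnit_det_denAt
  have h1 : ∀ a b : Matrix (Fin m) (Fin m) ℂ,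
      a * numAt h + b * denAt h = (a * act h (Complex.I • 1) + b) * denAt h := fun a b => by
    rw [act_I, Matrix.add_mul, Matrix.mul_assoc, Matrix.mul_assoc, Matrix.nonsing_inv_mul _ hu,
      Matrix.mul_one]
  rw [act_I (g * h), numAt_mul, denAt_mul, h1, h1, Matrix.mul_inv_rev, Matrix.mul_assoc,
    ← Matrix.mul_assoc (denAt h), Matrix.mul_nonsing_inv _ hu, Matrix.one_mul]
  rfl

lemma act_parabMat {m : ℕ} {a d : Matrix (Fin m) (Fin m) ℝ} (had : a * dᵀ = 1)
    (s : Matrix (Fin m) (Fin m) ℝ) (z : Matrix (Fin m) (Fin m) ℂ) :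
    act (parabMat a d s) z = cmat a * z * (cmat a)ᵀ + cmat s := by
  have h1 : d * aᵀ = 1 := by simpa using congrArg Matrix.transpose had
  have h2 : cmat d * (cmat a)ᵀ = 1 := by rw [← cmat_transpose, ← cmat_mul, h1, cmat_one]
  have h3 : cmat (0 : Matrix (Fin m) (Fin m) ℝ) = 0 := by ext; simp [cmat]
  have h4 : (cmat d)⁻¹ = (cmat a)ᵀ := Matrix.inv_eq_right_inv h2
  simp only [act, parabMat, Matrix.toBlocks_fromBlocks₁₁, Matrix.toBlocks_fromBlocks₁₂,
    Matrix.toBlocks_fromBlocks₂₁, Matrix.toBlocks_fromBlocks₂₂, h3, Matrix.zero_mul, zero_add, h4,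
    Matrix.add_mul, cmat_mul]
  rw [Matrix.mul_assoc (cmat s), h2, Matrix.mul_one]

lemma imPart_act_parabMat {m : ℕ} {a d : Matrix (Fin m) (Fin m) ℝ} (had : a * dᵀ = 1)
    (s : Matrix (Fin m) (Fin m) ℝ) (z : Matrix (Fin m) (Fin m) ℂ) :
    imPart (act (parabMat a d s) z) = a * imPart z * aᵀ := by
  rw [act_parabMat had]
  ext i j
  simp [imPart, cmat, Matrix.mul_apply]

lemma rePart_act_parabMat {m : ℕ} {a d : Matrix (Fin m) (Fin m) ℝ} (had : a * dᵀ = 1)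
    (s : Matrix (Fin m) (Fin m) ℝ) (z : Matrix (Fin m) (Fin m) ℂ) :
    rePart (act (parabMat a d s) z) = a * rePart z * aᵀ + s := by
  rw [act_parabMat had]
  ext i j
  simp [rePart, cmat, Matrix.mul_apply]

lemma exists_act_I_eq {m : ℕ} {z : Matrix (Fin m) (Fin m) ℂ} (hz : z ∈ SiegelUHS m) :
    ∃ p, IsSymplectic p ∧ act p (Complex.I • 1) = z := by
  obtain ⟨a, ha, hy⟩ := exists_eq_mul_transpose hz.2
  have had : a * (a⁻¹ᵀ)ᵀ = 1 := by rw [Matrix.transpose_transpose, Matrix.mul_nonsing_inv _ ha]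
  have hx : (rePart z)ᵀ = rePart z := by
    ext i j
    exact congrArg Complex.re (hz.1.apply i j)
  refine ⟨parabMat a a⁻¹ᵀ (rePart z), isSymplectic_parabMat had hx, ?_⟩
  rw [act_parabMat had, Matrix.mul_smul, Matrix.mul_one, Matrix.smul_mul, ← cmat_transpose,
    ← cmat_mul, ← hy]
  ext i j
  apply Complex.ext <;> simp [cmat, imPart, rePart]

end Parabolic

lemma Matrix.PosDef.abs_apply_le_trace {m : ℕ} {y : Matrix (Fin m) (Fin m) ℝ} (hy : y.PosDef)
    (i j : Fin m) : |y i j| ≤ y.trace := by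
  obtain ⟨a, -, rfl⟩ := exists_eq_mul_transpose hy
  have hrow : ∀ i, ∑ k, a i k ^ 2 ≤ (a * aᵀ).trace := fun i => by
    have h1 : (a * aᵀ).trace = ∑ i, ∑ k, a i k ^ 2 := by
      simp [Matrix.trace, Matrix.mul_apply, sq]
    rw [h1]
    exact Finset.single_le_sum (f := fun i => ∑ k, a i k ^ 2)
      (fun i _ => Finset.sum_nonneg fun k _ => sq_nonneg _) (Finset.mem_univ i)
  calc |(a * aᵀ) i j| ≤ ∑ k, |a i k * a j k| := by
        rw [Matrix.mul_apply]
        exact Finset.abs_sum_le_sum_abs _ _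
    _ ≤ ∑ k, (a i k ^ 2 + a j k ^ 2) / 2 := by
        refine Finset.sum_le_sum fun k _ => ?_
        rw [abs_mul, ← sq_abs (a i k), ← sq_abs (a j k)]
        nlinarith [sq_nonneg (|a i k| - |a j k|)]
    _ = (∑ k, a i k ^ 2 + ∑ k, a j k ^ 2) / 2 := by
        rw [← Finset.sum_div, Finset.sum_add_distrib]
    _ ≤ (a * aᵀ).trace := by linarith [hrow i, hrow j]

lemma Matrix.PosDef.det_le_trace_pow {m : ℕ} (hm : 1 ≤ m) {y : Matrix (Fin m) (Fin m) ℝ}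
    (hy : y.PosDef) : y.det ≤ (m.factorial * y.trace) ^ m := by
  have ht : 0 ≤ y.trace := (abs_nonneg _).trans (hy.abs_apply_le_trace ⟨0, hm⟩ ⟨0, hm⟩)
  have hf : (1 : ℝ) ≤ m.factorial := by exact_mod_cast Nat.one_le_iff_ne_zero.2 m.factorial_ne_zero
  have h1 := norm_det_le_of_norm_apply_le (A := cmat y) (x := y.trace) fun i j => by
    simpa [cmat] using hy.abs_apply_le_trace i j
  rw [cmat_det, Complex.norm_real, Real.norm_eq_abs] at h1
  calc y.det ≤ m.factorial * y.trace ^ m := (le_abs_self _).trans h1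
    _ ≤ (m.factorial : ℝ) ^ m * y.trace ^ m := by
        gcongr
        exact le_self_pow₀ hf (by omega)
    _ = _ := (mul_pow _ _ _).symm

lemma exists_one_add_rpow_le_exp_mul {M c : ℝ} (hM : 0 ≤ M) (hc : 0 < c) :
    ∃ C, 0 < C ∧ ∀ t, 0 ≤ t → (1 + t) ^ M ≤ C * Real.exp (c * t) := by
  obtain ⟨C, hC, h⟩ := exists_one_add_rpow_le_exp M
  refine ⟨(1 + c⁻¹) ^ M * C, by positivity, fun t ht => ?_⟩
  calc (1 + t) ^ M ≤ ((1 + c⁻¹) * (1 + c * t)) ^ M := by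
        refine Real.rpow_le_rpow (by positivity) ?_ hM
        have h1 : (1 + c⁻¹) * (1 + c * t) = 1 + t + (c * t + c⁻¹) := by
          field_simp
          ring
        rw [h1]
        exact le_add_of_nonneg_right (by positivity)
    _ = (1 + c⁻¹) ^ M * (1 + c * t) ^ M := Real.mul_rpow (by positivity) (by positivity)
    _ ≤ (1 + c⁻¹) ^ M * (C * Real.exp (c * t)) := by
        gcongr
        exact h _ (by positivity)
    _ = _ := (mul_assoc _ _ _).symm

lemma exists_exp_trace_mul_det_rpow_le (m : ℕ) {σ c : ℝ} (hσ : 0 < σ) (hc : 0 < c) :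
    ∃ C : ℝ, 0 ≤ C ∧ ∀ h : Matrix (Fin m ⊕ Fin m) (Fin m ⊕ Fin m) ℝ, IsSymplectic h →
      (∀ i j, |rePart (act h (Complex.I • 1)) i j| ≤ 1 / 2) →
      Real.exp (-(c * (imPart (act h (Complex.I • 1))).trace)) *
        (imPart (act h (Complex.I • 1))).det ^ σ ≤ C * ‖(cayA h).det‖⁻¹ ^ (2 * σ) := by
  obtain ⟨C, hC, hexp⟩ := exists_one_add_rpow_le_exp_mul (M := m * (2 * σ)) (by positivity) hc
  refine ⟨(m.factorial * 2 ^ m : ℝ) ^ (2 * σ) * C, by positivity, fun h hh hx => ?_⟩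
  have hY := hh.posDef_imPart_act_I
  have hdet := hh.det_imPart_act_I
  have hn : 0 < ‖(cayA h).det‖ := norm_pos_iff.2 hh.isPseudoUnitary.isUnit_det.ne_zero
  have hZ : ∀ i j, |(imPart (act h (Complex.I • 1))) i j| ≤ _ := hY.abs_apply_le_trace
  have ht : 0 ≤ (imPart (act h (Complex.I • 1))).trace := hY.posSemidef.trace_nonneg
  have hd := hY.det_pos
  generalize act h (Complex.I • 1) = Z at *
  set t := (imPart Z).trace
  set d := (imPart Z).det
  set n := ‖(cayA h).det‖
  have hN : ‖(Z + Complex.I • 1).det‖ ≤ m.factorial * (2 + t) ^ m := by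
    refine norm_det_le_of_norm_apply_le fun i j => ?_
    have h1 : ‖Z i j‖ ≤ 1 / 2 + t :=
      (Complex.norm_le_abs_re_add_abs_im _).trans (add_le_add (hx i j) (hZ i j))
    have h2 : ‖(Complex.I • (1 : Matrix (Fin m) (Fin m) ℂ)) i j‖ ≤ 1 := by
      by_cases hij : i = j <;> simp [hij]
    calc ‖(Z + Complex.I • 1) i j‖ ≤ ‖Z i j‖ + ‖(Complex.I • (1 : Matrix (Fin m) (Fin m) ℂ)) i j‖ :=
          norm_add_le _ _
      _ ≤ 2 + t := by linarith
  have hle : d ≤ (m.factorial * 2 ^ m * (1 + t) ^ m * n⁻¹) ^ 2 := by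
    have h2 : (1 : ℝ) ≤ 2 ^ m := one_le_pow₀ one_le_two
    have h3 : d * n ^ 2 ≤ (m.factorial * 2 ^ m * (1 + t) ^ m) ^ 2 := calc
      d * n ^ 2 ≤ d * (2 ^ m * n) ^ 2 := by
          gcongr
          exact le_mul_of_one_le_left hn.le h2
      _ = ‖(Z + Complex.I • 1).det‖ ^ 2 := hdet
      _ ≤ (m.factorial * (2 + t) ^ m) ^ 2 := by gcongr
      _ ≤ (m.factorial * 2 ^ m * (1 + t) ^ m) ^ 2 := by
          rw [mul_assoc, ← mul_pow]
          gcongr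
          linarith
    rw [mul_pow _ n⁻¹, inv_pow, ← div_eq_mul_inv, le_div_iff₀ (by positivity)]
    exact h3
  have hrp : d ^ σ ≤ (m.factorial * 2 ^ m : ℝ) ^ (2 * σ) * (1 + t) ^ (m * (2 * σ)) *
      n⁻¹ ^ (2 * σ) := calc
    d ^ σ ≤ ((m.factorial * 2 ^ m * (1 + t) ^ m * n⁻¹) ^ 2) ^ σ :=
        Real.rpow_le_rpow hd.le hle hσ.le
    _ = (m.factorial * 2 ^ m * (1 + t) ^ m * n⁻¹) ^ (2 * σ) := by
        rw [← Real.rpow_natCast, ← Real.rpow_mul (by positivity)]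
        norm_cast
    _ = _ := by
        rw [Real.mul_rpow (by positivity) (by positivity),
          Real.mul_rpow (by positivity) (by positivity), ← Real.rpow_natCast (1 + t) m,
          ← Real.rpow_mul (by positivity)]
  calc Real.exp (-(c * t)) * d ^ σ
      ≤ Real.exp (-(c * t)) * ((m.factorial * 2 ^ m : ℝ) ^ (2 * σ) * (C * Real.exp (c * t)) *
        n⁻¹ ^ (2 * σ)) := by
        gcongr
        refine hrp.trans ?_
        gcongr
        exact hexp t ht
    _ = (m.factorial * 2 ^ m : ℝ) ^ (2 * σ) * C * n⁻¹ ^ (2 * σ) *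
        (Real.exp (-(c * t)) * Real.exp (c * t)) := by ring
    _ = _ := by rw [← Real.exp_add, neg_add_cancel, Real.exp_zero, mul_one]

lemma realMat_det_mul_self {m : ℕ} {U V : Matrix (Fin m) (Fin m) ℤ} (hUV : U * V = 1) :
    (realMat U).det * (realMat U).det = 1 := by
  have h1 := congrArg Matrix.det hUV
  rw [Matrix.det_mul, Matrix.det_one] at h1
  have h2 := Int.isUnit_mul_self (IsUnit.of_mul_eq_one _ h1)
  rw [realMat_det]
  exact_mod_cast h2

lemma exists_integral_isSymm_abs_add_le {m : ℕ} {x : Matrix (Fin m) (Fin m) ℝ} (hx : xᵀ = x) :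
    ∃ s : Matrix (Fin m) (Fin m) ℝ, (∀ i j, ∃ n : ℤ, s i j = n) ∧ sᵀ = s ∧
      ∀ i j, |(x + s) i j| ≤ 1 / 2 := by
  choose f hf using exists_int_abs_add_le
  refine ⟨Matrix.of fun i j => (f (x i j) : ℝ), fun i j => ⟨_, rfl⟩, ?_, fun i j => ?_⟩
  · ext i j
    have h1 : x j i = x i j := congrFun (congrFun hx i) j
    simp [h1]
  · rw [Matrix.add_apply, Matrix.of_apply, add_comm]
    exact hf _

lemma IsReps.eq_of_parabMat_mul_eq {m : ℕ}
    {Γ R : Set (Matrix (Fin m ⊕ Fin m) (Fin m ⊕ Fin m) ℝ)} (hR : IsReps m Γ R)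
    {a d s s' : Matrix (Fin m) (Fin m) ℝ} (had : a * dᵀ = 1) (hd : ∀ i j, ∃ n : ℤ, d i j = n)
    (hs : ∀ i j, ∃ n : ℤ, s i j = n) (hs' : ∀ i j, ∃ n : ℤ, s' i j = n) (hss : sᵀ = s)
    (hss' : s'ᵀ = s') {γ γ' : Matrix (Fin m ⊕ Fin m) (Fin m ⊕ Fin m) ℝ} (hγ : γ ∈ R)
    (hγ' : γ' ∈ R) (h : parabMat a d s * γ = parabMat a d s' * γ') : γ = γ' := by
  have hda : dᵀ * a = 1 := mul_eq_one_comm.1 had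
  set T : Matrix (Fin m) (Fin m) ℝ := dᵀ * (s - s') * d with hT
  have hTi : ∀ i j, ∃ n : ℤ, T i j = n := by
    choose d' hd using hd
    choose u hs using hs
    choose v hs' using hs'
    exact fun i j => ⟨∑ k, (∑ l, d' l i * (u l k - v l k)) * d' k j, by
      simp [hT, Matrix.mul_apply, hd, hs, hs']⟩
  have hTs : T.IsSymm := by
    simp only [Matrix.IsSymm, hT, Matrix.transpose_mul, Matrix.transpose_sub, hss, hss',
      Matrix.transpose_transpose, Matrix.mul_assoc]
  have h1 : parabMat a d s = parabMat a d s' * Matrix.fromBlocks 1 T 0 1 := by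
    have h2 : a * T = (s - s') * d := by
      rw [hT, Matrix.mul_assoc, ← Matrix.mul_assoc, had, Matrix.one_mul]
    simp [parabMat, Matrix.fromBlocks_multiply, h2, Matrix.sub_mul]
  have h2 : Matrix.fromBlocks dᵀ (-(dᵀ * s')) 0 aᵀ * parabMat a d s' = 1 := by
    have h3 : aᵀ * d = 1 := by simpa using congrArg Matrix.transpose hda
    simp [parabMat, Matrix.fromBlocks_multiply, hda, h3, Matrix.mul_assoc, Matrix.fromBlocks_one]
  have h3 : γ' = Matrix.fromBlocks 1 T 0 1 * γ := by
    have h4 := congrArg (Matrix.fromBlocks dᵀ (-(dᵀ * s')) 0 aᵀ * ·) h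
    simp only [h1, ← Matrix.mul_assoc, h2, Matrix.one_mul] at h4
    exact h4.symm
  refine (hR.2 γ' (hR.1 hγ')).unique ⟨hγ, _, ⟨1, T, Or.inl rfl, hTi, hTs, by rw [one_smul]⟩, h3⟩
    ⟨hγ', 1, ⟨1, 0, Or.inl rfl, fun i j => ⟨0, by simp⟩, Matrix.isSymm_zero, ?_⟩, ?_⟩
  · rw [one_smul, Matrix.fromBlocks_one]
  · rw [Matrix.one_mul]

lemma exists_sum_exp_mul_det_rpow_le (m : ℕ) {σ : ℝ} (h₁ : (m : ℝ) < σ) (h₂ : σ < m + 1) :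
    ∃ C : ℝ, ∀ τ : Matrix (Fin m) (Fin m) ℝ, τ.PosDef → HalfIntegral τ →
      ∀ Γ R : Set (Matrix (Fin m ⊕ Fin m) (Fin m ⊕ Fin m) ℝ),
        IsModularSubgroup m Γ → IsReps m Γ R → ∀ z ∈ SiegelUHS m, ∀ F : Finset R,
          ∑ γ ∈ F, Real.exp (-(τ * imPart (act γ.1 z)).trace) *
            (imPart (act γ.1 z)).det ^ σ ≤ C := by
  have hσ : 0 < σ := (Nat.cast_nonneg m).trans_lt h₁
  obtain ⟨c, hc, htr⟩ := exists_unimodular_trace_le m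
  obtain ⟨C₁, hC₁, hle⟩ := exists_exp_trace_mul_det_rpow_le m hσ hc
  obtain ⟨C₂, hsum⟩ := exists_sum_cayA_le m h₁ h₂
  refine ⟨C₁ * C₂, fun τ hτ hτi Γ R hΓ hR z hz F => ?_⟩
  obtain ⟨U, V, hUV, hU⟩ := htr τ hτ hτi
  obtain ⟨p, hp, rfl⟩ := exists_act_I_eq hz
  have had : realMat U * (realMat V)ᵀᵀ = 1 := by
    rw [Matrix.transpose_transpose, ← realMat_mul, hUV, realMat_one]
  have hsymp : ∀ γ : R, IsSymplectic (γ.1 * p) := fun γ =>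
    (hΓ.symplectic _ (hR.1 γ.2)).mul hp
  have hshift : ∀ γ : R, ∃ s : Matrix (Fin m) (Fin m) ℝ, (∀ i j, ∃ n : ℤ, s i j = n) ∧ sᵀ = s ∧
      ∀ i j, |(realMat U * rePart (act (γ.1 * p) (Complex.I • 1)) *
        (realMat U)ᵀ + s) i j| ≤ 1 / 2 := fun γ => by
    refine exists_integral_isSymm_abs_add_le ?_
    have h1 : (rePart (act (γ.1 * p) (Complex.I • 1)))ᵀ =
        rePart (act (γ.1 * p) (Complex.I • 1)) := by
      ext i j
      exact congrArg Complex.re (congrFun (congrFun (hsymp γ).act_I_transpose i) j)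
    rw [Matrix.transpose_mul, Matrix.transpose_mul, h1, Matrix.transpose_transpose,
      Matrix.mul_assoc]
  choose s hsi hss hs using hshift
  have hVi : ∀ i j, ∃ n : ℤ, (realMat V)ᵀ i j = n := fun i j => ⟨V j i, rfl⟩
  let φ : R → Matrix (Fin m ⊕ Fin m) (Fin m ⊕ Fin m) ℝ := fun γ =>
    parabMat (realMat U) (realMat V)ᵀ (s γ) * γ.1
  have hφ : Function.Injective φ := fun γ γ' h => Subtype.ext <|
    hR.eq_of_parabMat_mul_eq had hVi (hsi γ) (hsi γ') (hss γ) (hss γ') γ.2 γ'.2 h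
  classical
  have hterm : ∀ γ : R, Real.exp (-(τ * imPart (act γ.1
      (act p (Complex.I • 1)))).trace) *
      (imPart (act γ.1 (act p (Complex.I • 1)))).det ^ σ ≤
      C₁ * ‖(cayA (φ γ * p)).det‖⁻¹ ^ (2 * σ) := fun γ => by
    have hφp : φ γ * p = parabMat (realMat U) (realMat V)ᵀ (s γ) * (γ.1 * p) :=
      Matrix.mul_assoc _ _ _
    have h1 := hle (φ γ * p) (by
      rw [hφp]
      exact (isSymplectic_parabMat had (hss γ)).mul (hsymp γ)) (by
      rw [hφp, act_mul_I _ (hsymp γ), rePart_act_parabMat had]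
      exact hs γ)
    refine le_trans ?_ h1
    rw [hφp, act_mul_I _ (hsymp γ), imPart_act_parabMat had, Matrix.det_mul, Matrix.det_mul,
      Matrix.det_transpose, mul_right_comm, realMat_det_mul_self hUV, one_mul,
      ← act_mul_I _ hp]
    have hY := (hsymp γ).posDef_imPart_act_I
    gcongr
    · exact Real.rpow_nonneg hY.det_pos.le _
    · exact hU _ hY
  calc _ ≤ ∑ γ ∈ F, C₁ * ‖(cayA (φ γ * p)).det‖⁻¹ ^ (2 * σ) :=
        Finset.sum_le_sum fun γ _ => hterm γ
    _ = C₁ * ∑ g ∈ F.image φ, ‖(cayA (g * p)).det‖⁻¹ ^ (2 * σ) := by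
        rw [Finset.sum_image hφ.injOn, Finset.mul_sum]
    _ ≤ C₁ * C₂ := by
        refine mul_le_mul_of_nonneg_left (hsum _ (fun g hg => ?_) p hp) hC₁
        obtain ⟨γ, -, rfl⟩ := Finset.mem_image.1 hg
        have hγ := hR.1 γ.2
        exact ⟨(isSymplectic_parabMat had (hss γ)).mul (hΓ.symplectic _ hγ),
          (isIntegralMat_parabMat (fun i j => ⟨U i j, rfl⟩) hVi (hsi γ)).mul (hΓ.integral _ hγ)⟩

lemma norm_term0_eq {m : ℕ} (τ : Matrix (Fin m) (Fin m) ℝ) (l₁ l₂ : ℂ)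
    (γ : Matrix (Fin m ⊕ Fin m) (Fin m ⊕ Fin m) ℝ) (z : Matrix (Fin m) (Fin m) ℂ)
    (ht : 0 < (τ * imPart (act γ z)).trace) (hd : 0 < (imPart (act γ z)).det) :
    ‖term0 τ l₁ l₂ γ z‖ = Real.exp (-(2 * Real.pi * (τ * imPart (act γ z)).trace)) *
      (τ * imPart (act γ z)).trace ^ l₁.re * (imPart (act γ z)).det ^ l₂.re := by
  have him : (cmat τ * act γ z).trace.im = (τ * imPart (act γ z)).trace := by
    simp [Matrix.trace, Matrix.mul_apply, cmat, imPart]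
  have hre : (2 * (Real.pi : ℂ) * Complex.I * (cmat τ * act γ z).trace).re =
      -(2 * Real.pi * (τ * imPart (act γ z)).trace) := by
    rw [← him]
    simp
  rw [term0, norm_mul, norm_mul, Complex.norm_exp, hre, Complex.norm_cpow_eq_rpow_re_of_pos ht,
    Complex.norm_cpow_eq_rpow_re_of_pos hd]

lemma exists_norm_term0_le {m : ℕ} (hm : 1 ≤ m) {K : Set (ℂ × ℂ)} (hK : IsCompact K)
    (hKR : K ⊆ Region0 m) :
    ∃ σ C : ℝ, (m : ℝ) < σ ∧ σ < m + 1 ∧ 0 ≤ C ∧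
      ∀ τ : Matrix (Fin m) (Fin m) ℝ, τ.PosDef → HalfIntegral τ →
        ∀ γ, IsSymplectic γ → ∀ z ∈ SiegelUHS m, ∀ p ∈ K, ‖term0 τ p.1 p.2 γ z‖ ≤
          C * (Real.exp (-(τ * imPart (act γ z)).trace) * (imPart (act γ z)).det ^ σ) := by
  obtain ⟨c, hc, htr⟩ := exists_unimodular_trace_le m
  obtain ⟨σ, C, h₁, h₂, hC, hmaj⟩ := exists_majorant hm hK hKR
    (c := m.factorial / c) (div_pos (by exact_mod_cast m.factorial_pos) hc)
  refine ⟨σ, C, h₁, h₂, hC, fun τ hτ hτi γ hγ z hz p hp => ?_⟩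
  obtain ⟨q, hq, rfl⟩ := exists_act_I_eq hz
  obtain ⟨U, V, hUV, hU⟩ := htr τ hτ hτi
  have had : realMat U * (realMat V)ᵀᵀ = 1 := by
    rw [Matrix.transpose_transpose, ← realMat_mul, hUV, realMat_one]
  have hγq := hγ.mul hq
  have hY := hγq.posDef_imPart_act_I
  have hY' := ((isSymplectic_parabMat had Matrix.transpose_zero).mul hγq).posDef_imPart_act_I
  rw [act_mul_I _ hγq, imPart_act_parabMat had, act_mul_I _ hq] at hY'
  rw [act_mul_I _ hq] at hY
  have := Fin.pos_iff_nonempty.1 hm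
  have hle := hU _ hY
  have ht : 0 < (τ * imPart (act γ (act q (Complex.I • 1)))).trace :=
    (mul_pos hc hY'.trace_pos).trans_le hle
  have hd := hY.det_pos
  rw [norm_term0_eq _ _ _ _ _ ht hd]
  refine hmaj p hp _ _ ht hd ?_
  calc (imPart (act γ (act q (Complex.I • 1)))).det
      = (realMat U * imPart (act γ (act q (Complex.I • 1))) * (realMat U)ᵀ).det := by
        rw [Matrix.det_mul, Matrix.det_mul, Matrix.det_transpose, mul_right_comm,
          realMat_det_mul_self hUV, one_mul]
    _ ≤ _ := hY'.det_le_trace_pow hm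
    _ ≤ _ := by
        have h3 := hY'.trace_pos.le
        rw [div_mul_eq_mul_div, mul_div_assoc]
        gcongr
        rwa [le_div_iff₀ hc, mul_comm]

/-- within the region (a)/(b) the series `S_τ(z,l₁,l₂)` converges absolutely,
with the sum of absolute values bounded by a constant depending only on `m, l₁, l₂`
(independent of `z ∈ ℌ_m`, of `τ`, and of the choice of representatives), and the convergence
is uniform for `(l₁,l₂)` in compact subsets of the region. -/
theorem statement0 (m : ℕ) (hm : 1 ≤ m) :
    (∀ l₁ l₂ : ℂ, (l₁, l₂) ∈ Region0 m →
      ∃ C : ℝ, ∀ τ : Matrix (Fin m) (Fin m) ℝ, τ.PosDef → HalfIntegral τ →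
        ∀ Γ R : Set (Matrix (Fin m ⊕ Fin m) (Fin m ⊕ Fin m) ℝ),
          IsModularSubgroup m Γ → IsReps m Γ R →
          ∀ z ∈ SiegelUHS m,
            Summable (fun γ : R => ‖term0 τ l₁ l₂ (γ : Matrix _ _ ℝ) z‖) ∧
            (∑' γ : R, ‖term0 τ l₁ l₂ (γ : Matrix _ _ ℝ) z‖) ≤ C) ∧
    (∀ K : Set (ℂ × ℂ), IsCompact K → K ⊆ Region0 m →
      ∀ τ : Matrix (Fin m) (Fin m) ℝ, τ.PosDef → HalfIntegral τ →
        ∀ Γ R : Set (Matrix (Fin m ⊕ Fin m) (Fin m ⊕ Fin m) ℝ),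
          IsModularSubgroup m Γ → IsReps m Γ R →
          ∀ z ∈ SiegelUHS m,
            TendstoUniformlyOn
              (fun (t : Finset R) (p : ℂ × ℂ) => ∑ γ ∈ t, term0 τ p.1 p.2 (γ : Matrix _ _ ℝ) z)
              (fun p => ∑' γ : R, term0 τ p.1 p.2 (γ : Matrix _ _ ℝ) z)
              Filter.atTop K) := by
  refine ⟨fun l₁ l₂ hl => ?_, fun K hK hKR τ hτ hτi Γ R hΓ hR z hz => ?_⟩
  · obtain ⟨σ, C, h₁, h₂, hC, hle⟩ := exists_norm_term0_le hm isCompact_singleton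
      (Set.singleton_subset_iff.2 hl)
    obtain ⟨D, hD⟩ := exists_sum_exp_mul_det_rpow_le m h₁ h₂
    refine ⟨C * D, fun τ hτ hτi Γ R hΓ hR z hz => ?_⟩
    have hsum : ∀ F : Finset R, ∑ γ ∈ F, ‖term0 τ l₁ l₂ γ.1 z‖ ≤ C * D := fun F => calc
      _ ≤ ∑ γ ∈ F, C * (Real.exp (-(τ * imPart (act γ.1 z)).trace) *
          (imPart (act γ.1 z)).det ^ σ) := Finset.sum_le_sum fun γ _ =>
            hle τ hτ hτi γ.1 (hΓ.symplectic _ (hR.1 γ.2)) z hz (l₁, l₂) (Set.mem_singleton _)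
      _ ≤ C * D := by
          rw [← Finset.mul_sum]
          exact mul_le_mul_of_nonneg_left (hD τ hτ hτi Γ R hΓ hR z hz F) hC
    have hs := summable_of_sum_le (fun γ : R => norm_nonneg (term0 τ l₁ l₂ γ.1 z)) hsum
    exact ⟨hs, hs.tsum_le_of_sum_le hsum⟩
  · obtain ⟨σ, C, h₁, h₂, hC, hle⟩ := exists_norm_term0_le hm hK hKR
    obtain ⟨D, hD⟩ := exists_sum_exp_mul_det_rpow_le m h₁ h₂
    have hs : Summable fun γ : R => Real.exp (-(τ * imPart (act γ.1 z)).trace) *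
        (imPart (act γ.1 z)).det ^ σ := by
      refine summable_of_sum_le (fun γ => ?_) (hD τ hτ hτi Γ R hΓ hR z hz)
      obtain ⟨q, hq, rfl⟩ := exists_act_I_eq hz
      rw [Pi.zero_apply, ← act_mul_I _ hq]
      exact mul_nonneg (Real.exp_nonneg _) (Real.rpow_nonneg
        ((hΓ.symplectic _ (hR.1 γ.2)).mul hq).posDef_imPart_act_I.det_pos.le _)
    exact tendstoUniformlyOn_tsum (hs.mul_left C) fun γ p hp =>
      hle τ hτ hτi γ.1 (hΓ.symplectic _ (hR.1 γ.2)) z hz p hp
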